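/- arXiv:2112.12374 — 2 statements merged into one kernel-verified Lean document; each statement's English description precedes it below -/
import Mathlib

section
/- Let d ≥ 3 and let K(x) = |x|^{-(d-2)} be the Coulomb kernel on ℝ^d (i.e. α = d-2). There exists a constant C > 0 depending only on d such that for every μ ∈ C_c^∞(ℝ^d;ℝ) and every bounded C¹ vector field u : ℝ^d → ℝ^d with bounded derivative, T(μ,u) ≤ C ‖∇u‖_{L^∞} E(μ), i.e. ∬_{ℝ^d×ℝ^d} μ(x) μ(y) u(x)·∇K(x-y) dx dy ≤ C ‖∇u‖_{L^∞} ∬_{ℝ^d×ℝ^d} μ(x) μ(y) |x-y|^{-(d-2)} dx dy. -/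
open MeasureTheory

noncomputable section

section CoulombPotential

open Filter Topology

/-- The Euclidean space of dimension `d`. -/
abbrev Space (d : ℕ) := EuclideanSpace ℝ (Fin d)

/-- The `i`-th partial derivative of a scalar function. -/
def partialDeriv {d : ℕ} (i : Fin d) (f : Space d → ℝ) (x : Space d) : ℝ :=
  fderiv ℝ f x (EuclideanSpace.single i 1)

/-- The Coulomb kernel `|z|^{-(d-2)}`. -/
def coulomb {d : ℕ} (z : Space d) : ℝ := ‖z‖ ^ (-((d : ℝ) - 2))

/-- The `i`-th component of the gradient of the Coulomb kernel. -/
def coulombGrad {d : ℕ} (i : Fin d) (z : Space d) : ℝ :=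
  -((d : ℝ) - 2) * ‖z‖ ^ (-((d : ℝ) - 2) - 2) * z i

/-- The smooth function `(|z|² + ε²)^p`, which tends to `|z|^{2p}` as `ε → 0`. -/
def regPow {d : ℕ} (p ε : ℝ) (z : Space d) : ℝ := (‖z‖ ^ 2 + ε ^ 2) ^ p

variable {d : ℕ}

section PartialDeriv

lemma ContDiff.continuous_partialDeriv {f : Space d → ℝ} (hf : ContDiff ℝ 1 f) (i : Fin d) :
    Continuous (partialDeriv i f) :=
  (hf.continuous_fderiv one_ne_zero).clm_apply continuous_const

lemma ContDiff.contDiff_partialDeriv {f : Space d → ℝ} (hf : ContDiff ℝ (⊤ : ℕ∞) f)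
    (i : Fin d) : ContDiff ℝ (⊤ : ℕ∞) (partialDeriv i f) :=
  (hf.fderiv_right (m := (⊤ : ℕ∞)) (by simp)).clm_apply contDiff_const

lemma HasCompactSupport.partialDeriv {f : Space d → ℝ} (hf : HasCompactSupport f) (i : Fin d) :
    HasCompactSupport (partialDeriv i f) :=
  hf.fderiv_apply ℝ _

lemma partialDeriv_mul {f g : Space d → ℝ} (hf : Differentiable ℝ f) (hg : Differentiable ℝ g)
    (i : Fin d) (x : Space d) :
    partialDeriv i (fun y => f y * g y) x
      = partialDeriv i f x * g x + f x * partialDeriv i g x := by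
  simp only [partialDeriv]
  rw [fderiv_fun_mul (hf x) (hg x)]
  simp
  ring

lemma partialDeriv_comm {f : Space d → ℝ} (hf : ContDiff ℝ (⊤ : ℕ∞) f) (i j : Fin d) :
    partialDeriv i (partialDeriv j f) = partialDeriv j (partialDeriv i f) := by
  have key : ∀ (i j : Fin d) x, partialDeriv i (partialDeriv j f) x
      = fderiv ℝ (fderiv ℝ f) x (EuclideanSpace.single i 1) (EuclideanSpace.single j 1) := by
    intro i j x
    have hd : DifferentiableAt ℝ (fderiv ℝ f) x :=
      (hf.fderiv_right (m := (⊤ : ℕ∞)) (by simp)).differentiable (by simp) x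
    change fderiv ℝ (fun y => fderiv ℝ f y (EuclideanSpace.single j 1)) x _ = _
    rw [fderiv_clm_apply hd (differentiableAt_const _)]
    simp
  funext x
  rw [key, key]
  have := (hf.contDiffAt (x := x)).isSymmSndFDerivAt
    (by simpa using WithTop.coe_le_coe.2 (le_top : (2 : ℕ∞) ≤ ⊤))
  exact this _ _

lemma partialDeriv_comp_const_sub {f : Space d → ℝ} (hf : Differentiable ℝ f) (i : Fin d)
    (x z : Space d) : partialDeriv i (fun y => f (x - y)) z = -partialDeriv i f (x - z) := by
  have h1 : HasFDerivAt (fun y : Space d => x - y) (-ContinuousLinearMap.id ℝ (Space d)) z :=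
    (hasFDerivAt_id z).const_sub x
  have h2 := (hf (x - z)).hasFDerivAt.comp z h1
  rw [partialDeriv, show (fun y => f (x - y)) = f ∘ fun y => x - y from rfl, h2.fderiv]
  simp [partialDeriv]

lemma integral_partialDeriv_eq_zero {f : Space d → ℝ} {i : Fin d} (hf : Differentiable ℝ f)
    (hfi : Integrable f) (hf' : Integrable (partialDeriv i f)) :
    ∫ x, partialDeriv i f x = 0 := by
  have := integral_mul_fderiv_eq_neg_fderiv_mul_of_integrable (μ := volume) (f := f)
    (g := fun _ => (1 : ℝ)) (v := EuclideanSpace.single i 1) (by simp only [mul_one]; exact hf')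
    (by simp) (by simpa using hfi) (fun x _ => hf x) (fun x _ => by fun_prop)
  simpa [partialDeriv] using this.symm

end PartialDeriv

section Kernel

lemma locallyIntegrable_norm_rpow_neg {s : ℝ} (hs : s < d) :
    LocallyIntegrable (fun z : Space d => ‖z‖ ^ (-s)) := by
  rcases Nat.eq_zero_or_pos d with rfl | hd
  · have : Subsingleton (Space 0) := inferInstance
    exact Continuous.locallyIntegrable (continuous_of_const fun a b => by rw [Subsingleton.elim a b])
  have : Nonempty (Fin d) := ⟨⟨0, hd⟩⟩
  rw [locallyIntegrable_iff]
  intro k hk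
  obtain ⟨r, hr, hkr⟩ := hk.isBounded.subset_ball_lt 0 0
  refine IntegrableOn.mono_set ?_ hkr
  refine (integrableOn_fun_norm_addHaar (volume : Measure (Space d))
    (f := fun y => y ^ (-s))).2 ?_
  have h := (intervalIntegrable_iff_integrableOn_Ioo_of_le hr.le).1
    (intervalIntegral.intervalIntegrable_rpow' (a := 0) (b := r)
      (r := (d : ℝ) - 1 - s) (by linarith))
  refine h.congr_fun (fun y hy => ?_) measurableSet_Ioo
  have hy0 : 0 < y := hy.1
  simp only [finrank_euclideanSpace, Fintype.card_fin, smul_eq_mul]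
  rw [← Real.rpow_natCast, ← Real.rpow_add hy0]
  congr 1
  rw [Nat.cast_sub hd]
  push_cast
  ring

lemma measurable_coulombGrad (i : Fin d) : Measurable (coulombGrad (d := d) i) := by
  unfold coulombGrad
  fun_prop

lemma abs_coulombGrad_le (hd : 3 ≤ d) (i : Fin d) (z : Space d) :
    |coulombGrad i z| ≤ ((d : ℝ) - 2) * ‖z‖ ^ (-((d : ℝ) - 1)) := by
  have hd' : (3 : ℝ) ≤ d := by exact_mod_cast hd
  have hz : |z i| ≤ ‖z‖ := PiLp.norm_apply_le z i
  rcases eq_or_ne z 0 with rfl | h0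
  · simp only [coulombGrad, PiLp.zero_apply, mul_zero, abs_zero]
    have : (0 : ℝ) ≤ d - 2 := by linarith
    positivity
  have hpos : 0 < ‖z‖ := norm_pos_iff.2 h0
  have hp : 0 ≤ ‖z‖ ^ (-((d : ℝ) - 2) - 2) := by positivity
  rw [coulombGrad, abs_mul, abs_mul, abs_neg, abs_of_nonneg (by linarith : (0 : ℝ) ≤ d - 2),
    abs_of_nonneg hp, mul_assoc]
  refine mul_le_mul_of_nonneg_left ?_ (by linarith)
  calc _ ≤ ‖z‖ ^ (-((d : ℝ) - 2) - 2) * ‖z‖ := by gcongr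
    _ = ‖z‖ ^ (-((d : ℝ) - 1)) := by
        rw [← Real.rpow_add_one hpos.ne']
        congr 1
        ring

lemma locallyIntegrable_coulomb : LocallyIntegrable (coulomb (d := d)) :=
  locallyIntegrable_norm_rpow_neg (by linarith)

lemma locallyIntegrable_coulombGrad (hd : 3 ≤ d) (i : Fin d) :
    LocallyIntegrable (coulombGrad (d := d) i) := by
  refine ((locallyIntegrable_norm_rpow_neg (d := d) (s := (d : ℝ) - 1) (by linarith)).smul
    ((d : ℝ) - 2)).mono (measurable_coulombGrad i).aestronglyMeasurable ?_
  refine Eventually.of_forall fun z => ?_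
  refine (abs_coulombGrad_le hd i z).trans (le_abs_self _)

lemma MeasureTheory.LocallyIntegrable.integrable_mul_of_hasCompactSupport {k φ : Space d → ℝ}
    (hk : LocallyIntegrable k) (hφ : Continuous φ) (h : HasCompactSupport φ) :
    Integrable (fun z => k z * φ z) :=
  hk.integrable_smul_right_of_hasCompactSupport hφ h

end Kernel

section Regularization

lemma contDiff_regPow {p ε : ℝ} (hε : 0 < ε) : ContDiff ℝ (⊤ : ℕ∞) (regPow (d := d) p ε) := by
  unfold regPow
  refine ContDiff.rpow_const_of_ne ?_ fun z => by positivity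
  exact (contDiff_norm_sq ℝ).add contDiff_const

lemma partialDeriv_regPow {p ε : ℝ} (hε : 0 < ε) (i : Fin d) (z : Space d) :
    partialDeriv i (regPow p ε) z = 2 * p * regPow (p - 1) ε z * z i := by
  have h1 : HasFDerivAt (fun z : Space d => ‖z‖ ^ 2 + ε ^ 2) (2 • (innerSL ℝ z)) z :=
    (hasStrictFDerivAt_norm_sq z).hasFDerivAt.add_const _
  have h2 := h1.rpow_const (p := p) (Or.inl (by positivity))
  unfold partialDeriv
  change fderiv ℝ (fun z : Space d => (‖z‖ ^ 2 + ε ^ 2) ^ p) z _ = _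
  rw [h2.fderiv]
  simp [regPow, EuclideanSpace.inner_single_right]
  ring

lemma regPow_nonneg (p ε : ℝ) (z : Space d) : 0 ≤ regPow p ε z := by
  unfold regPow
  positivity

lemma regPow_neg_le {p : ℝ} (hp : 0 ≤ p) (ε : ℝ) {z : Space d} (hz : z ≠ 0) :
    regPow (-p) ε z ≤ ‖z‖ ^ (-(2 * p)) := by
  have hpos : 0 < ‖z‖ := norm_pos_iff.2 hz
  have : ‖z‖ ^ (-(2 * p)) = (‖z‖ ^ 2) ^ (-p) := by
    rw [← Real.rpow_natCast, ← Real.rpow_mul hpos.le]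
    congr 1
    push_cast
    ring
  rw [this]
  exact Real.rpow_le_rpow_of_nonpos (by positivity) (by nlinarith [sq_nonneg ε]) (by linarith)

lemma tendsto_regPow (p : ℝ) {z : Space d} (hz : z ≠ 0) :
    Tendsto (fun ε => regPow p ε z) (𝓝[>] 0) (𝓝 (‖z‖ ^ (2 * p))) := by
  have hpos : 0 < ‖z‖ := norm_pos_iff.2 hz
  have h : ContinuousAt (fun ε : ℝ => regPow p ε z) 0 := by
    unfold regPow
    refine ContinuousAt.rpow_const (by fun_prop) (Or.inl ?_)
    positivity
  have h0 : regPow p 0 z = ‖z‖ ^ (2 * p) := by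
    simp only [regPow]
    rw [Real.rpow_mul hpos.le]
    norm_num
  rw [← h0]
  exact h.tendsto.mono_left nhdsWithin_le_nhds

lemma ae_ne_zero (hd : 3 ≤ d) : ∀ᵐ z : Space d, z ≠ 0 := by
  have : Nonempty (Fin d) := ⟨⟨0, by omega⟩⟩
  exact Measure.ae_ne volume 0

/-- The gradient of the regularized kernel `(|z|² + ε²)^{-(d-2)/2}`. -/
lemma partialDeriv_regCoulomb {ε : ℝ} (hε : 0 < ε) (i : Fin d) (z : Space d) :
    partialDeriv i (regPow (-(((d : ℝ) - 2) / 2)) ε) z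
      = -((d : ℝ) - 2) * regPow (-((d : ℝ) / 2)) ε z * z i := by
  rw [partialDeriv_regPow hε]
  have : -(((d : ℝ) - 2) / 2) - 1 = -((d : ℝ) / 2) := by ring
  rw [this]
  ring

/-- The regularized kernel has the Laplacian `-d(d-2) ε² (|z|² + ε²)^{-(d+2)/2}`. -/
lemma laplacian_regCoulomb {ε : ℝ} (hε : 0 < ε) (z : Space d) :
    ∑ i, partialDeriv i (partialDeriv i (regPow (-(((d : ℝ) - 2) / 2)) ε)) z
      = -((d : ℝ) * ((d : ℝ) - 2)) * (ε ^ 2 * regPow (-(((d : ℝ) + 2) / 2)) ε z) := by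
  have hterm : ∀ i : Fin d, partialDeriv i (partialDeriv i (regPow (-(((d : ℝ) - 2) / 2)) ε)) z
      = -((d : ℝ) - 2) * (regPow (-((d : ℝ) / 2)) ε z
        - d * regPow (-(((d : ℝ) + 2) / 2)) ε z * (z i) ^ 2) := by
    intro i
    have hfun : partialDeriv i (regPow (d := d) (-(((d : ℝ) - 2) / 2)) ε)
        = fun y => (-((d : ℝ) - 2) * regPow (-((d : ℝ) / 2)) ε y) * y i :=
      funext fun y => partialDeriv_regCoulomb hε i y
    have hr : Differentiable ℝ (regPow (d := d) (-((d : ℝ) / 2)) ε) :=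
      (contDiff_regPow hε).differentiable (by simp)
    have hc : Differentiable ℝ (fun y : Space d => y i) := by fun_prop
    have hci : partialDeriv i (fun y : Space d => y i) z = 1 := by
      have : HasFDerivAt (fun y : Space d => y i) (EuclideanSpace.proj i : Space d →L[ℝ] ℝ) z :=
        (EuclideanSpace.proj i : Space d →L[ℝ] ℝ).hasFDerivAt
      rw [partialDeriv, this.fderiv]
      simp
    have hcst : partialDeriv i (fun _ : Space d => -((d : ℝ) - 2)) z = 0 := by
      simp [partialDeriv]
    rw [hfun, partialDeriv_mul (hr.const_mul _) hc, partialDeriv_mul (by fun_prop) hr, hci, hcst,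
      partialDeriv_regPow hε]
    have : -((d : ℝ) / 2) - 1 = -(((d : ℝ) + 2) / 2) := by ring
    rw [this]
    ring
  simp only [hterm]
  rw [← Finset.mul_sum, Finset.sum_sub_distrib, ← Finset.mul_sum]
  have hsq : ∑ i, (z i) ^ 2 = ‖z‖ ^ 2 := by
    rw [EuclideanSpace.norm_sq_eq]
    simp
  have hsplit : regPow (-((d : ℝ) / 2)) ε z
      = (‖z‖ ^ 2 + ε ^ 2) * regPow (-(((d : ℝ) + 2) / 2)) ε z := by
    simp only [regPow]
    have hpos : 0 < ‖z‖ ^ 2 + ε ^ 2 := by positivity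
    rw [mul_comm, ← Real.rpow_add_one hpos.ne']
    congr 1
    ring
  rw [hsq, hsplit]
  simp
  ring

end Regularization

section Distribution

lemma integral_mul_partialDeriv {k φ : Space d → ℝ} (hk : ContDiff ℝ 1 k) (hφ : ContDiff ℝ 1 φ)
    (hc : HasCompactSupport φ) (i : Fin d) :
    ∫ z, k z * partialDeriv i φ z = -∫ z, partialDeriv i k z * φ z := by
  refine integral_mul_fderiv_eq_neg_fderiv_mul_of_integrable ?_ ?_ ?_
    (fun x _ => hk.differentiable one_ne_zero x) (fun x _ => hφ.differentiable one_ne_zero x)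
  · exact ((hk.continuous_partialDeriv i).mul hφ.continuous).integrable_of_hasCompactSupport
      hc.mul_left
  · exact (hk.continuous.mul (hφ.continuous_partialDeriv i)).integrable_of_hasCompactSupport
      (hc.partialDeriv i).mul_left
  · exact (hk.continuous.mul hφ.continuous).integrable_of_hasCompactSupport hc.mul_left

lemma tendsto_integral_regCoulomb_mul (hd : 3 ≤ d) {φ : Space d → ℝ} (hφ : Continuous φ)
    (hc : HasCompactSupport φ) :
    Tendsto (fun ε => ∫ z, regPow (-(((d : ℝ) - 2) / 2)) ε z * φ z) (𝓝[>] 0)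
      (𝓝 (∫ z, coulomb z * φ z)) := by
  have hd' : (3 : ℝ) ≤ d := by exact_mod_cast hd
  refine tendsto_integral_filter_of_dominated_convergence (fun z => ‖coulomb z * φ z‖) ?_ ?_
    (locallyIntegrable_coulomb.integrable_mul_of_hasCompactSupport hφ hc).norm ?_
  · filter_upwards [self_mem_nhdsWithin] with ε hε
    exact ((contDiff_regPow hε).continuous.mul hφ).aestronglyMeasurable
  · refine Eventually.of_forall fun ε => ?_
    filter_upwards [ae_ne_zero hd] with z hz
    rw [norm_mul, norm_mul]
    refine mul_le_mul_of_nonneg_right ?_ (norm_nonneg _)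
    rw [Real.norm_of_nonneg (regPow_nonneg _ _ _)]
    refine (regPow_neg_le (by linarith) ε hz).trans ?_
    rw [mul_div_cancel₀ _ (two_ne_zero)]
    exact le_abs_self _
  · filter_upwards [ae_ne_zero hd] with z hz
    refine Tendsto.mul_const _ ?_
    have := tendsto_regPow (-(((d : ℝ) - 2) / 2)) hz
    rwa [show 2 * -(((d : ℝ) - 2) / 2) = -((d : ℝ) - 2) by ring] at this

lemma tendsto_integral_partialDeriv_regCoulomb_mul (hd : 3 ≤ d) (i : Fin d) {φ : Space d → ℝ}
    (hφ : Continuous φ) (hc : HasCompactSupport φ) :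
    Tendsto (fun ε => ∫ z, partialDeriv i (regPow (-(((d : ℝ) - 2) / 2)) ε) z * φ z) (𝓝[>] 0)
      (𝓝 (∫ z, coulombGrad i z * φ z)) := by
  refine tendsto_integral_filter_of_dominated_convergence (fun z => ‖coulombGrad i z * φ z‖) ?_ ?_
    ((locallyIntegrable_coulombGrad hd i).integrable_mul_of_hasCompactSupport hφ hc).norm ?_
  · filter_upwards [self_mem_nhdsWithin] with ε hε
    exact ((((contDiff_regPow hε).of_le (by simp)).continuous_partialDeriv i).mul
      hφ).aestronglyMeasurable
  · filter_upwards [self_mem_nhdsWithin] with ε hε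
    filter_upwards [ae_ne_zero hd] with z hz
    rw [norm_mul, norm_mul, partialDeriv_regCoulomb hε, coulombGrad, norm_mul, norm_mul _ (z i),
      norm_mul, norm_mul]
    gcongr
    rw [Real.norm_of_nonneg (regPow_nonneg _ _ _)]
    refine (regPow_neg_le (by positivity) ε hz).trans ?_
    rw [mul_div_cancel₀ _ (two_ne_zero), show -((d : ℝ) - 2) - 2 = -d by ring]
    exact le_abs_self _
  · filter_upwards [ae_ne_zero hd] with z hz
    refine Tendsto.mul_const _ ?_
    have h := tendsto_regPow (-((d : ℝ) / 2)) hz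
    rw [show 2 * -((d : ℝ) / 2) = -((d : ℝ) - 2) - 2 by ring] at h
    refine ((h.const_mul (-((d : ℝ) - 2))).mul_const (z i)).congr' ?_
    filter_upwards [self_mem_nhdsWithin] with ε hε
    rw [partialDeriv_regCoulomb hε]

/-- `coulombGrad i` is the distributional derivative of `coulomb`. -/
lemma integral_coulomb_mul_partialDeriv (hd : 3 ≤ d) {φ : Space d → ℝ} (hφ : ContDiff ℝ 1 φ)
    (hc : HasCompactSupport φ) (i : Fin d) :
    ∫ z, coulomb z * partialDeriv i φ z = -∫ z, coulombGrad i z * φ z := by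
  refine tendsto_nhds_unique (tendsto_integral_regCoulomb_mul hd (hφ.continuous_partialDeriv i)
    (hc.partialDeriv i)) ?_
  refine (tendsto_integral_partialDeriv_regCoulomb_mul hd i hφ.continuous hc).neg.congr' ?_
  filter_upwards [self_mem_nhdsWithin] with ε hε
  exact (integral_mul_partialDeriv ((contDiff_regPow hε).of_le (by simp)) hφ hc i).symm

/-- The constant `c` in `-Δ |z|^{-(d-2)} = c δ₀`. -/
def laplaceConst (d : ℕ) : ℝ :=
  (d : ℝ) * ((d : ℝ) - 2) * ∫ z : Space d, regPow (-(((d : ℝ) + 2) / 2)) 1 z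

lemma integrable_regPow_one :
    Integrable (regPow (d := d) (-(((d : ℝ) + 2) / 2)) 1) := by
  have h := integrable_rpow_neg_one_add_norm_sq (E := Space d) (μ := volume) (r := (d : ℝ) + 2)
    (by simp)
  refine h.congr (Eventually.of_forall fun z => ?_)
  simp only [regPow]
  rw [add_comm (1 : ℝ), one_pow, neg_div]

lemma laplaceConst_pos (hd : 3 ≤ d) : 0 < laplaceConst d := by
  have hd' : (3 : ℝ) ≤ d := by exact_mod_cast hd
  refine mul_pos (mul_pos (by linarith) (by linarith)) ?_
  rw [integral_pos_iff_support_of_nonneg (fun z => regPow_nonneg _ _ z) integrable_regPow_one]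
  have : Function.support (regPow (d := d) (-(((d : ℝ) + 2) / 2)) 1) = Set.univ := by
    refine Set.eq_univ_of_forall fun z => ?_
    have : 0 < regPow (d := d) (-(((d : ℝ) + 2) / 2)) 1 z := by
      unfold regPow
      positivity
    exact this.ne'
  rw [this]
  exact isOpen_univ.measure_pos volume Set.univ_nonempty

lemma integral_regPow_mul_eq {ε : ℝ} (hε : 0 < ε) (φ : Space d → ℝ) :
    ∫ z, ε ^ 2 * regPow (-(((d : ℝ) + 2) / 2)) ε z * φ z
      = ∫ w, regPow (-(((d : ℝ) + 2) / 2)) 1 w * φ (ε • w) := by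
  have h := Measure.integral_comp_smul (volume : Measure (Space d))
    (fun z => ε ^ 2 * regPow (-(((d : ℝ) + 2) / 2)) ε z * φ z) ε
  have hpow : (0 : ℝ) < ε ^ d := by positivity
  simp only [finrank_euclideanSpace, Fintype.card_fin, smul_eq_mul] at h
  rw [abs_of_pos (inv_pos.2 hpow), eq_inv_mul_iff_mul_eq₀ hpow.ne'] at h
  rw [← h, ← integral_const_mul]
  congr 1
  funext w
  have : regPow (-(((d : ℝ) + 2) / 2)) ε (ε • w)
      = ε ^ (-((d : ℝ) + 2)) * regPow (-(((d : ℝ) + 2) / 2)) 1 w := by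
    simp only [regPow]
    rw [norm_smul, Real.norm_of_nonneg hε.le,
      show (ε * ‖w‖) ^ 2 + ε ^ 2 = ε ^ 2 * (‖w‖ ^ 2 + 1 ^ 2) by ring,
      Real.mul_rpow (by positivity) (by positivity)]
    congr 1
    rw [← Real.rpow_natCast, ← Real.rpow_mul hε.le]
    congr 1
    push_cast
    ring
  rw [this, Real.rpow_neg hε.le, Real.rpow_add hε, Real.rpow_natCast]
  norm_num
  field_simp

lemma tendsto_integral_laplacian {φ : Space d → ℝ} (hφ : Continuous φ)
    (hc : HasCompactSupport φ) :
    Tendsto (fun ε : ℝ => ∫ w, regPow (-(((d : ℝ) + 2) / 2)) 1 w * φ (ε • w)) (𝓝[>] 0)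
      (𝓝 (∫ w : Space d, regPow (-(((d : ℝ) + 2) / 2)) 1 w * φ 0)) := by
  obtain ⟨M, hM⟩ := hφ.bounded_above_of_compact_support hc
  refine tendsto_integral_filter_of_dominated_convergence
    (fun w => regPow (-(((d : ℝ) + 2) / 2)) 1 w * M) ?_ ?_ (integrable_regPow_one.mul_const M) ?_
  · refine Eventually.of_forall fun ε => ?_
    exact ((contDiff_regPow one_pos).continuous.mul
      (hφ.comp (continuous_const_smul ε))).aestronglyMeasurable
  · refine Eventually.of_forall fun ε => Eventually.of_forall fun w => ?_
    rw [norm_mul, Real.norm_of_nonneg (regPow_nonneg _ _ _)]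
    exact mul_le_mul_of_nonneg_left (hM _) (regPow_nonneg _ _ _)
  · refine Eventually.of_forall fun w => Tendsto.const_mul _ ?_
    have h : Continuous fun ε : ℝ => φ (ε • w) := by fun_prop
    have := (h.tendsto 0).mono_left (nhdsWithin_le_nhds (s := Set.Ioi 0))
    simpa using this

/-- The Coulomb kernel is a multiple of the fundamental solution of the Laplacian. -/
lemma sum_integral_coulombGrad_mul_partialDeriv (hd : 3 ≤ d) {φ : Space d → ℝ}
    (hφ : ContDiff ℝ 1 φ) (hc : HasCompactSupport φ) :
    ∑ i, ∫ z, coulombGrad i z * partialDeriv i φ z = laplaceConst d * φ 0 := by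
  have h1 := tendsto_finsetSum Finset.univ fun i _ =>
    tendsto_integral_partialDeriv_regCoulomb_mul hd i (hφ.continuous_partialDeriv i)
      (hc.partialDeriv i)
  refine tendsto_nhds_unique h1 ?_
  have h2 := (tendsto_integral_laplacian hφ.continuous hc).const_mul ((d : ℝ) * ((d : ℝ) - 2))
  rw [integral_mul_const, ← mul_assoc] at h2
  rw [laplaceConst]
  refine h2.congr' ?_
  filter_upwards [self_mem_nhdsWithin] with ε hε
  have hsm := contDiff_regPow (d := d) (p := -(((d : ℝ) - 2) / 2)) hε
  rw [← integral_regPow_mul_eq hε, ← integral_const_mul]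
  have hibp : ∀ i : Fin d, ∫ z, partialDeriv i (regPow (-(((d : ℝ) - 2) / 2)) ε) z *
      partialDeriv i φ z
      = -∫ z, partialDeriv i (partialDeriv i (regPow (-(((d : ℝ) - 2) / 2)) ε)) z * φ z :=
    fun i => integral_mul_partialDeriv ((hsm.contDiff_partialDeriv i).of_le (by simp)) hφ hc i
  simp only [hibp]
  rw [Finset.sum_neg_distrib, ← integral_finsetSum, ← integral_neg]
  · congr 1
    funext z
    rw [← Finset.sum_mul, laplacian_regCoulomb hε]
    ring
  · intro i _
    exact ((((hsm.contDiff_partialDeriv i).contDiff_partialDeriv i).continuous).mul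
      hφ.continuous).integrable_of_hasCompactSupport hc.mul_left

end Distribution

section Decay

/-- `f` is continuous and `O((1 + |x|)^{-s})`. -/
def Decays (s : ℝ) (f : Space d → ℝ) : Prop :=
  Continuous f ∧ ∃ B, ∀ x, |f x| ≤ B * (1 + ‖x‖) ^ (-s)

lemma Decays.mul {s t : ℝ} {f g : Space d → ℝ} (hf : Decays s f) (hg : Decays t g) :
    Decays (s + t) (fun x => f x * g x) := by
  obtain ⟨hfc, B, hB⟩ := hf
  obtain ⟨hgc, B', hB'⟩ := hg
  refine ⟨hfc.mul hgc, B * B', fun x => ?_⟩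
  have hpos : 0 < 1 + ‖x‖ := by positivity
  calc |f x * g x| = |f x| * |g x| := abs_mul _ _
    _ ≤ (B * (1 + ‖x‖) ^ (-s)) * (B' * (1 + ‖x‖) ^ (-t)) :=
        mul_le_mul (hB x) (hB' x) (abs_nonneg _) ((abs_nonneg _).trans (hB x))
    _ = B * B' * (1 + ‖x‖) ^ (-(s + t)) := by
        rw [neg_add, Real.rpow_add hpos]
        ring

lemma Decays.integrable {s : ℝ} {f : Space d → ℝ} (hf : Decays s f) (hs : d < s) :
    Integrable f := by
  obtain ⟨hfc, B, hB⟩ := hf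
  refine Integrable.mono' ((integrable_one_add_norm (r := s) (by simpa using hs)).const_mul B)
    hfc.aestronglyMeasurable (Eventually.of_forall fun x => hB x)

lemma decays_zero {f : Space d → ℝ} (hf : Continuous f) {M : ℝ} (hM : ∀ x, |f x| ≤ M) :
    Decays 0 f :=
  ⟨hf, M, fun x => by simpa using hM x⟩

lemma Decays.mono {s t : ℝ} {f : Space d → ℝ} (hf : Decays s f) (hts : t ≤ s) : Decays t f := by
  obtain ⟨hfc, B, hB⟩ := hf
  have hB0 : 0 ≤ B := by simpa using (abs_nonneg _).trans (hB 0)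
  refine ⟨hfc, B, fun x => (hB x).trans ?_⟩
  gcongr
  linarith [norm_nonneg x]

/-- Integration by parts for a product of three decaying functions. -/
lemma integral_partialDeriv_mul_mul {α β γ : ℝ} (h : d < α + (β + γ)) {i : Fin d}
    {a p q : Space d → ℝ} (ha : ContDiff ℝ 1 a) (hp : ContDiff ℝ 1 p) (hq : ContDiff ℝ 1 q)
    (ha0 : Decays α a) (ha1 : Decays α (partialDeriv i a)) (hp0 : Decays β p)
    (hp1 : Decays β (partialDeriv i p)) (hq0 : Decays γ q) (hq1 : Decays γ (partialDeriv i q)) :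
    (∫ x, partialDeriv i a x * (p x * q x)) + (∫ x, a x * (partialDeriv i p x * q x))
      + (∫ x, a x * (p x * partialDeriv i q x)) = 0 := by
  have da := ha.differentiable one_ne_zero
  have dp := hp.differentiable one_ne_zero
  have dq := hq.differentiable one_ne_zero
  have I1 := (ha1.mul (hp0.mul hq0)).integrable h
  have I2 := (ha0.mul (hp1.mul hq0)).integrable h
  have I3 := (ha0.mul (hp0.mul hq1)).integrable h
  have hder : partialDeriv i (fun x => a x * (p x * q x)) = fun x =>
      partialDeriv i a x * (p x * q x) + a x * (partialDeriv i p x * q x)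
        + a x * (p x * partialDeriv i q x) := by
    funext x
    rw [partialDeriv_mul da (dp.fun_mul dq), partialDeriv_mul dp dq]
    ring
  have I12 : Integrable fun x =>
      partialDeriv i a x * (p x * q x) + a x * (partialDeriv i p x * q x) := I1.add I2
  have hz := integral_partialDeriv_eq_zero (i := i) (da.fun_mul (dp.fun_mul dq))
    ((ha0.mul (hp0.mul hq0)).integrable h) (by rw [hder]; exact I12.add I3)
  rwa [hder, integral_add I12 I3, integral_add I1 I2] at hz

end Decay

section Potential

/-- The convolution of the kernel `k` with the density `f`. -/
def potential (k f : Space d → ℝ) (x : Space d) : ℝ := ∫ z, k z * f (x - z)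

lemma potential_eq_convolution (k f : Space d → ℝ) :
    potential k f = convolution k f (ContinuousLinearMap.mul ℝ ℝ) volume := rfl

lemma potential_eq (k f : Space d → ℝ) (x : Space d) :
    potential k f x = ∫ y, f y * k (x - y) := by
  rw [potential, ← integral_sub_left_eq_self (fun y => f y * k (x - y)) volume x]
  simp [mul_comm]

lemma contDiff_potential {k f : Space d → ℝ} (hk : LocallyIntegrable k)
    (hf : ContDiff ℝ (⊤ : ℕ∞) f) (hc : HasCompactSupport f) :
    ContDiff ℝ (⊤ : ℕ∞) (potential k f) :=
  hc.contDiff_convolution_right (ContinuousLinearMap.mul ℝ ℝ) hk hf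

lemma partialDeriv_potential {k f : Space d → ℝ} (hk : LocallyIntegrable k)
    (hf : ContDiff ℝ (⊤ : ℕ∞) f) (hc : HasCompactSupport f) (i : Fin d) :
    partialDeriv i (potential k f) = potential k (partialDeriv i f) := by
  funext x
  have h1 : ContDiff ℝ 1 f := hf.of_le (by simp)
  rw [potential_eq_convolution, partialDeriv,
    (hc.hasFDerivAt_convolution_right _ hk h1 x).fderiv,
    convolution_precompR_apply _ hk (hc.fderiv ℝ) (h1.continuous_fderiv one_ne_zero)]
  rfl

lemma decays_potential {k f : Space d → ℝ} {s C : ℝ} (hs : 0 ≤ s) (hk : LocallyIntegrable k)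
    (hkb : ∀ z, |k z| ≤ C * ‖z‖ ^ (-s)) (hf : Continuous f) (hc : HasCompactSupport f) :
    Decays s (potential k f) := by
  have hcont : Continuous (potential k f) :=
    hc.continuous_convolution_right (ContinuousLinearMap.mul ℝ ℝ) hk hf
  obtain ⟨R, hR, hsub⟩ := hc.isCompact.isBounded.subset_ball_lt 1 0
  obtain ⟨M, hM⟩ := (isCompact_closedBall (0 : Space d) (2 * R)).exists_bound_of_continuousOn
    hcont.continuousOn
  have hM0 : 0 ≤ M := (norm_nonneg _).trans (hM 0 (by simp; linarith))
  refine ⟨hcont, M * (1 + 2 * R) ^ s + |C| * 4 ^ s * ∫ y, |f y|, fun x => ?_⟩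
  have hA : 0 ≤ ∫ y, |f y| := integral_nonneg fun y => abs_nonneg _
  have hx : 0 < 1 + ‖x‖ := by positivity
  have hw : 0 < (1 + ‖x‖) ^ (-s) := by positivity
  rw [add_mul]
  rcases le_or_gt ‖x‖ (2 * R) with h | h
  · have h1 : |potential k f x| ≤ M := hM x (by simpa using h)
    have h2 : 1 ≤ (1 + 2 * R) ^ s * (1 + ‖x‖) ^ (-s) := by
      rw [Real.rpow_neg hx.le, ← div_eq_mul_inv, one_le_div (by positivity)]
      exact Real.rpow_le_rpow hx.le (by linarith) hs
    have h3 : 0 ≤ |C| * 4 ^ s * (∫ y, |f y|) * (1 + ‖x‖) ^ (-s) := by positivity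
    nlinarith
  · have h3 : 0 ≤ M * (1 + 2 * R) ^ s * (1 + ‖x‖) ^ (-s) := by
      have : 0 < 1 + 2 * R := by linarith
      positivity
    have hbound : ∀ y, ‖f y * k (x - y)‖ ≤ |C| * 4 ^ s * (1 + ‖x‖) ^ (-s) * |f y| := by
      intro y
      by_cases hy : f y = 0
      · simp [hy]
      have hyR : ‖y‖ < R := by
        have := hsub (subset_tsupport f (Function.mem_support.2 hy))
        simpa using this
      have hxy : (1 + ‖x‖) / 4 ≤ ‖x - y‖ := by
        have := norm_sub_norm_le x y
        linarith
      rw [norm_mul, mul_comm, Real.norm_eq_abs, Real.norm_eq_abs]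
      refine mul_le_mul_of_nonneg_right ?_ (abs_nonneg _)
      have hp : ‖x - y‖ ^ (-s) ≤ ((1 + ‖x‖) / 4) ^ (-s) :=
        Real.rpow_le_rpow_of_nonpos (by positivity) hxy (by linarith)
      have he : ((1 + ‖x‖) / 4) ^ (-s) = 4 ^ s * (1 + ‖x‖) ^ (-s) := by
        rw [Real.div_rpow hx.le (by norm_num), Real.rpow_neg (by norm_num : (0 : ℝ) ≤ 4)]
        field_simp
      rw [he] at hp
      calc |k (x - y)| ≤ C * ‖x - y‖ ^ (-s) := hkb _
        _ ≤ |C| * ‖x - y‖ ^ (-s) := by gcongr; exact le_abs_self C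
        _ ≤ |C| * (4 ^ s * (1 + ‖x‖) ^ (-s)) := by gcongr
        _ = _ := by ring
    have hfi : Integrable f := hf.integrable_of_hasCompactSupport hc
    have := norm_integral_le_of_norm_le (hfi.abs.const_mul _) (Eventually.of_forall hbound)
    rw [← potential_eq, integral_const_mul, Real.norm_eq_abs] at this
    linarith

lemma potential_coulombGrad (hd : 3 ≤ d) {f : Space d → ℝ} (hf : ContDiff ℝ (⊤ : ℕ∞) f)
    (hc : HasCompactSupport f) (i : Fin d) :
    potential (coulombGrad i) f = partialDeriv i (potential coulomb f) := by
  rw [partialDeriv_potential locallyIntegrable_coulomb hf hc]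
  funext x
  have hsub : HasCompactSupport (fun y => f (x - y)) :=
    hc.comp_homeomorph (Homeomorph.subLeft x)
  have h := integral_coulomb_mul_partialDeriv hd (φ := fun y => f (x - y))
    ((hf.of_le (by simp)).comp (contDiff_const.sub contDiff_id)) hsub i
  simp only [partialDeriv_comp_const_sub (hf.differentiable (by simp)), mul_neg,
    integral_neg, neg_inj] at h
  exact h.symm

/-- The potential of `f` solves the Poisson equation. -/
lemma sum_partialDeriv_potential_coulombGrad (hd : 3 ≤ d) {f : Space d → ℝ}
    (hf : ContDiff ℝ (⊤ : ℕ∞) f) (hc : HasCompactSupport f) (x : Space d) :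
    ∑ i, partialDeriv i (potential (coulombGrad i) f) x = -(laplaceConst d * f x) := by
  have hsub : HasCompactSupport (fun y => f (x - y)) :=
    hc.comp_homeomorph (Homeomorph.subLeft x)
  have h := sum_integral_coulombGrad_mul_partialDeriv hd (φ := fun y => f (x - y))
    ((hf.of_le (by simp)).comp (contDiff_const.sub contDiff_id)) hsub
  simp only [partialDeriv_comp_const_sub (hf.differentiable (by simp)), mul_neg,
    integral_neg, Finset.sum_neg_distrib, sub_zero] at h
  rw [← h, neg_neg]
  refine Finset.sum_congr rfl fun i _ => ?_
  rw [partialDeriv_potential (locallyIntegrable_coulombGrad hd i) hf hc]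
  rfl

end Potential

section Energy

/-- The cutoff function `R² / (|x|² + R²)`. -/
def cutoff (R : ℝ) (x : Space d) : ℝ := R ^ 2 * regPow (-1) R x

lemma cutoff_eq (R : ℝ) (x : Space d) : cutoff R x = R ^ 2 * (‖x‖ ^ 2 + R ^ 2)⁻¹ := by
  rw [cutoff, regPow, Real.rpow_neg_one]

lemma contDiff_cutoff {R : ℝ} (hR : 0 < R) : ContDiff ℝ (⊤ : ℕ∞) (cutoff (d := d) R) :=
  contDiff_const.mul (contDiff_regPow hR)

lemma partialDeriv_cutoff {R : ℝ} (hR : 0 < R) (i : Fin d) (x : Space d) :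
    partialDeriv i (cutoff R) x = -2 * (cutoff R x * ((‖x‖ ^ 2 + R ^ 2)⁻¹ * x i)) := by
  have h1 : partialDeriv i (cutoff R) x = R ^ 2 * partialDeriv i (regPow (-1) R) x := by
    have := partialDeriv_mul (f := fun _ : Space d => R ^ 2) (by fun_prop)
      ((contDiff_regPow (p := -1) hR).differentiable (by simp)) i x
    simpa [partialDeriv, cutoff] using! this
  have hpos : 0 < ‖x‖ ^ 2 + R ^ 2 := by positivity
  rw [h1, partialDeriv_regPow hR, cutoff_eq]
  have : regPow (-1 - 1) R x = (‖x‖ ^ 2 + R ^ 2)⁻¹ * (‖x‖ ^ 2 + R ^ 2)⁻¹ := by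
    rw [regPow, sub_eq_add_neg, Real.rpow_add hpos, Real.rpow_neg_one]
  rw [this]
  ring

lemma cutoff_nonneg (R : ℝ) (x : Space d) : 0 ≤ cutoff R x := by
  rw [cutoff_eq]
  positivity

lemma cutoff_le_one {R : ℝ} (hR : 0 < R) (x : Space d) : cutoff R x ≤ 1 := by
  rw [cutoff_eq, ← div_eq_mul_inv, div_le_one (by positivity)]
  nlinarith [sq_nonneg ‖x‖]

lemma inv_sq_add_sq_le {R : ℝ} (hR : 1 ≤ R) (x : Space d) :
    (‖x‖ ^ 2 + R ^ 2)⁻¹ ≤ 2 * (1 + ‖x‖) ^ (-1 : ℝ) := by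
  rw [Real.rpow_neg_one, ← div_eq_mul_inv, inv_eq_one_div,
    div_le_div_iff₀ (by positivity) (by positivity)]
  nlinarith [sq_nonneg (‖x‖ - 1)]

lemma abs_partialDeriv_cutoff_le {R : ℝ} (hR : 1 ≤ R) (i : Fin d) (x : Space d) :
    |partialDeriv i (cutoff R) x| ≤ 4 * (1 + ‖x‖) ^ (-1 : ℝ) := by
  have hx : |x i| ≤ ‖x‖ := PiLp.norm_apply_le x i
  have hpos : 0 < ‖x‖ ^ 2 + R ^ 2 := by positivity
  have h1 : (‖x‖ ^ 2 + R ^ 2)⁻¹ * |x i| ≤ 2 * (1 + ‖x‖) ^ (-1 : ℝ) := by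
    rw [Real.rpow_neg_one, ← div_eq_mul_inv, inv_mul_eq_div,
      div_le_div_iff₀ (by positivity) (by positivity)]
    nlinarith [sq_nonneg (‖x‖ - 1), norm_nonneg x]
  rw [partialDeriv_cutoff (by linarith), abs_mul, abs_mul, abs_mul,
    abs_of_nonneg (cutoff_nonneg R x), abs_of_pos (inv_pos.2 hpos)]
  have h2 : 0 ≤ (‖x‖ ^ 2 + R ^ 2)⁻¹ * |x i| := by positivity
  have h3 := mul_le_mul (cutoff_le_one (by linarith : 0 < R) x) h1 h2 zero_le_one
  norm_num
  linarith

lemma tendsto_inv_sq_add_sq (x : Space d) :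
    Tendsto (fun R : ℝ => (‖x‖ ^ 2 + R ^ 2)⁻¹) atTop (𝓝 0) :=
  tendsto_inv_atTop_zero.comp (tendsto_atTop_add_const_left _ _ (tendsto_pow_atTop two_ne_zero))

lemma tendsto_cutoff (x : Space d) : Tendsto (fun R : ℝ => cutoff R x) atTop (𝓝 1) := by
  have h := ((tendsto_inv_sq_add_sq x).const_mul (‖x‖ ^ 2)).const_sub 1
  rw [mul_zero, sub_zero] at h
  refine h.congr' ?_
  filter_upwards [eventually_gt_atTop 0] with R hR
  rw [cutoff_eq]
  have : 0 < ‖x‖ ^ 2 + R ^ 2 := by positivity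
  field_simp
  ring

lemma tendsto_partialDeriv_cutoff (i : Fin d) (x : Space d) :
    Tendsto (fun R : ℝ => partialDeriv i (cutoff R) x) atTop (𝓝 0) := by
  have h := ((tendsto_cutoff x).mul ((tendsto_inv_sq_add_sq x).mul_const (x i))).const_mul (-2)
  rw [zero_mul, mul_zero, mul_zero] at h
  refine h.congr' ?_
  filter_upwards [eventually_gt_atTop 0] with R hR
  rw [partialDeriv_cutoff hR]

lemma decays_cutoff {R : ℝ} (hR : 1 ≤ R) : Decays 1 (cutoff (d := d) R) := by
  refine ⟨(contDiff_cutoff (by linarith)).continuous, R ^ 2 * 2, fun x => ?_⟩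
  rw [abs_of_nonneg (cutoff_nonneg R x), cutoff_eq, mul_assoc]
  exact mul_le_mul_of_nonneg_left (inv_sq_add_sq_le hR x) (sq_nonneg R)

lemma decays_partialDeriv_cutoff {R : ℝ} (hR : 1 ≤ R) (i : Fin d) :
    Decays 1 (partialDeriv i (cutoff (d := d) R)) :=
  ⟨((contDiff_cutoff (by linarith)).of_le (by simp)).continuous_partialDeriv i, 4,
    abs_partialDeriv_cutoff_le hR i⟩

lemma decays_one_rpow : Decays (d := d) 1 (fun x => (1 + ‖x‖) ^ (-1 : ℝ)) := by
  refine ⟨?_, 1, fun x => ?_⟩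
  · exact Continuous.rpow_const (by fun_prop) fun x => Or.inl (by positivity)
  · rw [one_mul, abs_of_nonneg (by positivity)]

lemma tendsto_integral_cutoff_mul {f : Space d → ℝ} (hf : Integrable f) :
    Tendsto (fun R : ℝ => ∫ x, cutoff R x * f x) atTop (𝓝 (∫ x, f x)) := by
  refine tendsto_integral_filter_of_dominated_convergence (fun x => ‖f x‖) ?_ ?_ hf.norm ?_
  · filter_upwards [eventually_gt_atTop 0] with R hR
    exact (contDiff_cutoff hR).continuous.aestronglyMeasurable.mul hf.aestronglyMeasurable
  · filter_upwards [eventually_gt_atTop 0] with R hR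
    refine Eventually.of_forall fun x => ?_
    rw [norm_mul, Real.norm_of_nonneg (cutoff_nonneg R x)]
    exact mul_le_of_le_one_left (norm_nonneg _) (cutoff_le_one hR x)
  · refine Eventually.of_forall fun x => ?_
    simpa using (tendsto_cutoff x).mul_const (f x)

lemma tendsto_integral_partialDeriv_cutoff_mul {s : ℝ} (hs : d < 1 + s) (i : Fin d)
    {f : Space d → ℝ} (hf : Decays s f) :
    Tendsto (fun R : ℝ => ∫ x, partialDeriv i (cutoff R) x * f x) atTop (𝓝 0) := by
  rw [← integral_zero (Space d) ℝ (μ := volume)]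
  refine tendsto_integral_filter_of_dominated_convergence
    (fun x => 4 * ‖(1 + ‖x‖) ^ (-1 : ℝ) * f x‖) ?_ ?_
    (((decays_one_rpow.mul hf).integrable hs).norm.const_mul 4) ?_
  · filter_upwards [eventually_ge_atTop 1] with R hR
    exact ((decays_partialDeriv_cutoff hR i).mul hf).1.aestronglyMeasurable
  · filter_upwards [eventually_ge_atTop 1] with R hR
    refine Eventually.of_forall fun x => ?_
    rw [norm_mul, norm_mul, Real.norm_of_nonneg (by positivity : 0 ≤ (1 + ‖x‖) ^ (-1 : ℝ)),
      ← mul_assoc]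
    exact mul_le_mul_of_nonneg_right (abs_partialDeriv_cutoff_le hR i x) (norm_nonneg _)
  · refine Eventually.of_forall fun x => ?_
    simpa using (tendsto_partialDeriv_cutoff i x).mul_const (f x)

lemma decays_potential_coulomb (hd : 3 ≤ d) {f : Space d → ℝ} (hf : Continuous f)
    (hc : HasCompactSupport f) : Decays ((d : ℝ) - 2) (potential coulomb f) := by
  have hd' : (3 : ℝ) ≤ d := by exact_mod_cast hd
  refine decays_potential (C := 1) (by linarith) locallyIntegrable_coulomb (fun z => ?_) hf hc
  rw [coulomb, one_mul, abs_of_nonneg (by positivity)]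

lemma decays_potential_coulombGrad (hd : 3 ≤ d) {f : Space d → ℝ} (hf : Continuous f)
    (hc : HasCompactSupport f) (i : Fin d) :
    Decays ((d : ℝ) - 1) (potential (coulombGrad i) f) := by
  have hd' : (3 : ℝ) ≤ d := by exact_mod_cast hd
  exact decays_potential (by linarith) (locallyIntegrable_coulombGrad hd i)
    (abs_coulombGrad_le hd i) hf hc

lemma decays_partialDeriv_potential_coulombGrad (hd : 3 ≤ d) {f : Space d → ℝ}
    (hf : ContDiff ℝ (⊤ : ℕ∞) f) (hc : HasCompactSupport f) (i j : Fin d) :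
    Decays ((d : ℝ) - 1) (partialDeriv j (potential (coulombGrad i) f)) := by
  rw [partialDeriv_potential (locallyIntegrable_coulombGrad hd i) hf hc]
  exact decays_potential_coulombGrad hd (hf.contDiff_partialDeriv j).continuous
    (hc.partialDeriv j) i

/-- The Coulomb energy is a multiple of the squared `L²` norm of the electric field. -/
lemma laplaceConst_mul_energy (hd : 3 ≤ d) {f : Space d → ℝ}
    (hf : ContDiff ℝ (⊤ : ℕ∞) f) (hc : HasCompactSupport f) :
    laplaceConst d * (∫ x, f x * potential coulomb f x)
      = ∑ i, ∫ x, potential (coulombGrad i) f x * potential (coulombGrad i) f x := by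
  have hd' : (3 : ℝ) ≤ d := by exact_mod_cast hd
  set h := potential coulomb f
  set g : Fin d → Space d → ℝ := fun i => potential (coulombGrad i) f with hg
  have hhc : ContDiff ℝ (⊤ : ℕ∞) h := contDiff_potential locallyIntegrable_coulomb hf hc
  have hgc : ∀ i, ContDiff ℝ (⊤ : ℕ∞) (g i) := fun i =>
    contDiff_potential (locallyIntegrable_coulombGrad hd i) hf hc
  have hdh : Decays ((d : ℝ) - 2) h := decays_potential_coulomb hd hf.continuous hc
  have hdg : ∀ i, Decays ((d : ℝ) - 1) (g i) := decays_potential_coulombGrad hd hf.continuous hc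
  have hdgg : ∀ i, Decays ((d : ℝ) - 1) (partialDeriv i (g i)) := fun i =>
    decays_partialDeriv_potential_coulombGrad hd hf hc i i
  have hgh : ∀ i, partialDeriv i h = g i := fun i => (potential_coulombGrad hd hf hc i).symm
  have hsum : ∀ R : ℝ, 1 ≤ R → ∑ i, ((∫ x, partialDeriv i (cutoff R) x * (h x * g i x))
      + ∫ x, cutoff R x * (g i x * g i x))
      = laplaceConst d * ∫ x, cutoff R x * (f x * h x) := by
    intro R hR
    have hi : ∀ i, (∫ x, partialDeriv i (cutoff R) x * (h x * g i x))
        + (∫ x, cutoff R x * (g i x * g i x))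
        = -∫ x, cutoff R x * (h x * partialDeriv i (g i) x) := by
      intro i
      have := integral_partialDeriv_mul_mul (α := 1) (β := (d : ℝ) - 2) (γ := (d : ℝ) - 1)
        (i := i) (by linarith) ((contDiff_cutoff (by linarith : 0 < R)).of_le (by simp))
        (hhc.of_le (by simp)) ((hgc i).of_le (by simp)) (decays_cutoff hR)
        (decays_partialDeriv_cutoff hR i) hdh (by rw [hgh]; exact (hdg i).mono (by linarith))
        (hdg i) (hdgg i)
      rw [hgh] at this
      linarith
    rw [Finset.sum_congr rfl fun i _ => hi i, Finset.sum_neg_distrib, ← integral_finsetSum,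
      ← integral_neg, ← integral_const_mul]
    · congr 1
      funext x
      rw [← Finset.mul_sum, ← Finset.mul_sum, sum_partialDeriv_potential_coulombGrad hd hf hc]
      ring
    · intro i _
      exact ((decays_cutoff hR).mul (hdh.mul (hdgg i))).integrable (by linarith)
  have hl : Tendsto (fun R : ℝ => ∑ i, ((∫ x, partialDeriv i (cutoff R) x * (h x * g i x))
      + ∫ x, cutoff R x * (g i x * g i x))) atTop (𝓝 (∑ i, (0 + ∫ x, g i x * g i x))) := by
    refine tendsto_finsetSum _ fun i _ => ?_
    exact (tendsto_integral_partialDeriv_cutoff_mul (s := ((d : ℝ) - 2) + ((d : ℝ) - 1))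
      (by linarith) i (hdh.mul (hdg i))).add
      (tendsto_integral_cutoff_mul (((hdg i).mul (hdg i)).integrable (by linarith)))
  have hr : Tendsto (fun R : ℝ => laplaceConst d * ∫ x, cutoff R x * (f x * h x)) atTop
      (𝓝 (laplaceConst d * ∫ x, f x * h x)) :=
    (tendsto_integral_cutoff_mul ((hf.continuous.mul
      hhc.continuous).integrable_of_hasCompactSupport hc.mul_right)).const_mul _
  have := tendsto_nhds_unique hr (hl.congr' (by
    filter_upwards [eventually_ge_atTop 1] with R hR using hsum R hR))
  simpa using this

end Energy

section StressTensor

/-- The stress-energy tensor identity, integrated against a bounded `C¹` vector field `v` with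
bounded derivative. -/
lemma laplaceConst_mul_transport (hd : 3 ≤ d) {f : Space d → ℝ} (hf : ContDiff ℝ (⊤ : ℕ∞) f)
    (hc : HasCompactSupport f) {v : Fin d → Space d → ℝ} (hv : ∀ i, ContDiff ℝ 1 (v i))
    (hv0 : ∀ i, Decays 0 (v i)) (hv1 : ∀ i j, Decays 0 (partialDeriv j (v i))) :
    laplaceConst d * ∑ i, (∫ x, f x * (v i x * potential (coulombGrad i) f x))
      = ∑ i, ∑ j, (∫ x, partialDeriv j (v i) x *
          (potential (coulombGrad i) f x * potential (coulombGrad j) f x))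
        - 1 / 2 * ∑ i, ∑ j, ∫ x, partialDeriv j (v j) x *
          (potential (coulombGrad i) f x * potential (coulombGrad i) f x) := by
  have hd' : (3 : ℝ) ≤ d := by exact_mod_cast hd
  set g : Fin d → Space d → ℝ := fun i => potential (coulombGrad i) f with hg
  have hgc : ∀ i, ContDiff ℝ 1 (g i) := fun i =>
    (contDiff_potential (locallyIntegrable_coulombGrad hd i) hf hc).of_le (by simp)
  have hdg : ∀ i, Decays ((d : ℝ) - 1) (g i) := decays_potential_coulombGrad hd hf.continuous hc
  have hdgg : ∀ i j, Decays ((d : ℝ) - 1) (partialDeriv j (g i)) :=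
    decays_partialDeriv_potential_coulombGrad hd hf hc
  have hsymm : ∀ i j, partialDeriv j (g i) = partialDeriv i (g j) := by
    intro i j
    simp only [hg, potential_coulombGrad hd hf hc]
    exact partialDeriv_comm (contDiff_potential locallyIntegrable_coulomb hf hc) j i
  have hexp : (d : ℝ) < 0 + (((d : ℝ) - 1) + ((d : ℝ) - 1)) := by linarith
  have hA : ∀ i j, (∫ x, partialDeriv j (v i) x * (g i x * g j x))
      + (∫ x, v i x * (g j x * partialDeriv i (g j) x))
      + (∫ x, v i x * (g i x * partialDeriv j (g j) x)) = 0 := by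
    intro i j
    have := integral_partialDeriv_mul_mul hexp (hv i) (hgc i) (hgc j) (hv0 i) (hv1 i j) (hdg i)
      (hdgg i j) (hdg j) (hdgg j j)
    rw [hsymm i j] at this
    simpa only [mul_comm (partialDeriv i (g j) _)] using this
  have hB : ∀ i j, (∫ x, partialDeriv j (v j) x * (g i x * g i x))
      + 2 * (∫ x, v j x * (g i x * partialDeriv j (g i) x)) = 0 := by
    intro i j
    have := integral_partialDeriv_mul_mul hexp (hv j) (hgc i) (hgc i) (hv0 j) (hv1 j j) (hdg i)
      (hdgg i j) (hdg i) (hdgg i j)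
    simp only [mul_comm (partialDeriv j (g i) _)] at this
    linarith
  have hC : ∀ i, ∑ j, (∫ x, v i x * (g i x * partialDeriv j (g j) x))
      = -(laplaceConst d * ∫ x, f x * (v i x * g i x)) := by
    intro i
    rw [← integral_finsetSum, ← integral_const_mul, ← integral_neg]
    · congr 1
      funext x
      rw [← Finset.mul_sum, ← Finset.mul_sum, sum_partialDeriv_potential_coulombGrad hd hf hc]
      ring
    · intro j _
      exact ((hv0 i).mul ((hdg i).mul (hdgg j j))).integrable hexp
  have sA : ∑ i, ∑ j, (∫ x, partialDeriv j (v i) x * (g i x * g j x))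
      + ∑ i, ∑ j, (∫ x, v i x * (g j x * partialDeriv i (g j) x))
      + ∑ i, ∑ j, (∫ x, v i x * (g i x * partialDeriv j (g j) x)) = 0 := by
    simp only [← Finset.sum_add_distrib, hA, Finset.sum_const_zero]
  have sB : ∑ i, ∑ j, (∫ x, partialDeriv j (v j) x * (g i x * g i x))
      + 2 * ∑ i, ∑ j, (∫ x, v j x * (g i x * partialDeriv j (g i) x)) = 0 := by
    simp only [Finset.mul_sum, ← Finset.sum_add_distrib, hB, Finset.sum_const_zero]
  rw [Finset.sum_congr rfl fun i _ => hC i, Finset.sum_neg_distrib, ← Finset.mul_sum] at sA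
  rw [Finset.sum_comm (f := fun i j => ∫ x, v j x * (g i x * partialDeriv j (g i) x))] at sB
  linarith

lemma abs_integral_mul_mul_le {s S : ℝ} (hs : d < s + s) {a p q : Space d → ℝ}
    (ha : ∀ x, |a x| ≤ S) (hp : Decays s p) (hq : Decays s q) :
    |∫ x, a x * (p x * q x)| ≤ S * (((∫ x, p x * p x) + ∫ x, q x * q x) / 2) := by
  have Ip := (hp.mul hp).integrable hs
  have Iq := (hq.mul hq).integrable hs
  have hb : ∀ x, ‖a x * (p x * q x)‖ ≤ S * ((p x * p x + q x * q x) / 2) := by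
    intro x
    rw [norm_mul, Real.norm_eq_abs, Real.norm_eq_abs]
    refine mul_le_mul (ha x) ?_ (abs_nonneg _) ((abs_nonneg _).trans (ha x))
    rw [abs_le]
    constructor <;> nlinarith [sq_nonneg (p x - q x), sq_nonneg (p x + q x)]
  have := norm_integral_le_of_norm_le (((Ip.add Iq).div_const 2).const_mul S)
    (Eventually.of_forall hb)
  simp only [Pi.add_apply] at this
  rwa [integral_const_mul, integral_div, integral_add Ip Iq] at this

lemma laplaceConst_mul_transport_le (hd : 3 ≤ d) {f : Space d → ℝ} (hf : ContDiff ℝ (⊤ : ℕ∞) f)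
    (hc : HasCompactSupport f) {v : Fin d → Space d → ℝ} (hv : ∀ i, ContDiff ℝ 1 (v i))
    (hv0 : ∀ i, Decays 0 (v i)) {S : ℝ} (hS : ∀ i j x, |partialDeriv j (v i) x| ≤ S) :
    laplaceConst d * ∑ i, ∫ x, f x * (v i x * potential (coulombGrad i) f x)
      ≤ 3 / 2 * d * S *
        ∑ i, ∫ x, potential (coulombGrad i) f x * potential (coulombGrad i) f x := by
  have hd' : (3 : ℝ) ≤ d := by exact_mod_cast hd
  rw [laplaceConst_mul_transport hd hf hc hv hv0 fun i j =>
    decays_zero ((hv i).continuous_partialDeriv j) (hS i j)]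
  set g : Fin d → Space d → ℝ := fun i => potential (coulombGrad i) f with hg
  set G : Fin d → ℝ := fun i => ∫ x, g i x * g i x
  have hdg : ∀ i, Decays ((d : ℝ) - 1) (g i) := decays_potential_coulombGrad hd hf.continuous hc
  have hexp : (d : ℝ) < ((d : ℝ) - 1) + ((d : ℝ) - 1) := by linarith
  have h1 : ∑ i, ∑ j, ∫ x, partialDeriv j (v i) x * (g i x * g j x)
      ≤ ∑ i, ∑ j, S * ((G i + G j) / 2) :=
    Finset.sum_le_sum fun i _ => Finset.sum_le_sum fun j _ =>
      (abs_le.1 (abs_integral_mul_mul_le hexp (hS i j) (hdg i) (hdg j))).2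
  have h2 : ∑ i, ∑ j, -(S * ((G i + G i) / 2))
      ≤ ∑ i, ∑ j, ∫ x, partialDeriv j (v j) x * (g i x * g i x) :=
    Finset.sum_le_sum fun i _ => Finset.sum_le_sum fun j _ =>
      (abs_le.1 (abs_integral_mul_mul_le hexp (hS j j) (hdg i) (hdg i))).1
  have e1 : ∑ i, ∑ j, S * ((G i + G j) / 2) = d * S * ∑ i, G i := by
    simp only [← Finset.mul_sum, ← Finset.sum_div, Finset.sum_add_distrib, Finset.sum_const,
      Finset.card_univ, Fintype.card_fin, nsmul_eq_mul]
    ring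
  have e2 : ∑ i : Fin d, ∑ j : Fin d, -(S * ((G i + G i) / 2)) = -(d * S * ∑ i, G i) := by
    simp only [Finset.sum_const, Finset.card_univ, Fintype.card_fin, nsmul_eq_mul,
      Finset.sum_neg_distrib, ← Finset.mul_sum, ← Finset.sum_div, Finset.sum_add_distrib]
    ring
  rw [e1] at h1
  rw [e2] at h2
  linarith

end StressTensor

lemma partialDeriv_apply {u : Space d → Space d} (hu : ContDiff ℝ 1 u) (i j : Fin d)
    (x : Space d) :
    partialDeriv j (fun y => u y i) x = fderiv ℝ u x (EuclideanSpace.single j 1) i := by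
  have h := (EuclideanSpace.proj i : Space d →L[ℝ] ℝ).hasFDerivAt.comp x
    (hu.differentiable one_ne_zero x).hasFDerivAt
  rw [partialDeriv, show (fun y => u y i) = (EuclideanSpace.proj i : Space d →L[ℝ] ℝ) ∘ u from rfl,
    h.fderiv]
  rfl

end CoulombPotential

/-- Modulated interaction energy estimate for the Coulomb kernel
`K(x) = |x|^{-(d-2)}` on `ℝ^d`, `d ≥ 3`: there is `C > 0` depending only on `d` such that
for every `μ ∈ C_c^∞(ℝ^d)` and every bounded `C¹` vector field `u` with bounded derivative,
`∬ μ(x) μ(y) u(x)·∇K(x-y) dx dy ≤ C ‖∇u‖_{L^∞} ∬ μ(x) μ(y) |x-y|^{-(d-2)} dx dy`. -/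
theorem stmt_0 (d : ℕ) (hd : 3 ≤ d) :
    ∃ C : ℝ, 0 < C ∧
      ∀ μ : EuclideanSpace ℝ (Fin d) → ℝ,
        ContDiff ℝ (⊤ : ℕ∞) μ → HasCompactSupport μ →
        ∀ u : EuclideanSpace ℝ (Fin d) → EuclideanSpace ℝ (Fin d),
          ContDiff ℝ 1 u →
          (∃ M : ℝ, ∀ x, ‖u x‖ ≤ M) →
          (∃ M : ℝ, ∀ x, ‖fderiv ℝ u x‖ ≤ M) →
          (∫ x, ∫ y, μ x * μ y *
              (-((d : ℝ) - 2) * ‖x - y‖ ^ (-((d : ℝ) - 2) - 2) *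
                ∑ i, u x i * (x i - y i)))
            ≤ C * (⨆ x, ‖fderiv ℝ u x‖) *
              ∫ x, ∫ y, μ x * μ y * ‖x - y‖ ^ (-((d : ℝ) - 2)) := by
  have hd' : (3 : ℝ) ≤ d := by exact_mod_cast hd
  refine ⟨3 / 2 * d, by linarith, fun μ hμ hc u hu ⟨M, hM⟩ ⟨M', hM'⟩ => ?_⟩
  have hbdd : BddAbove (Set.range fun x => ‖fderiv ℝ u x‖) := ⟨M', by rintro _ ⟨x, rfl⟩; exact hM' x⟩
  set S := ⨆ x, ‖fderiv ℝ u x‖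
  have hv : ∀ i, ContDiff ℝ 1 fun x => u x i := fun i =>
    (EuclideanSpace.proj i : Space d →L[ℝ] ℝ).contDiff.comp hu
  have hv0 : ∀ i, Decays 0 fun x => u x i := fun i =>
    decays_zero (hv i).continuous fun x => (PiLp.norm_apply_le (u x) i).trans (hM x)
  have hS : ∀ i j x, |partialDeriv j (fun y => u y i) x| ≤ S := by
    intro i j x
    rw [partialDeriv_apply hu]
    refine (PiLp.norm_apply_le _ i).trans (((fderiv ℝ u x).le_opNorm _).trans ?_)
    simpa using le_ciSup hbdd x
  have hT : (∫ x, ∫ y, μ x * μ y * (-((d : ℝ) - 2) * ‖x - y‖ ^ (-((d : ℝ) - 2) - 2) *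
      ∑ i, u x i * (x i - y i)))
      = ∑ i, ∫ x, μ x * (u x i * potential (coulombGrad i) μ x) := by
    rw [← integral_finsetSum]
    · congr 1
      funext x
      have hint : ∀ i, Integrable fun y => μ x * (u x i * (μ y * coulombGrad i (x - y))) := by
        intro i
        refine Integrable.const_mul (Integrable.const_mul ?_ _) _
        have := ((locallyIntegrable_coulombGrad hd i).integrable_mul_of_hasCompactSupport
          (φ := fun y => μ (x - y)) (by fun_prop)
          (hc.comp_homeomorph (Homeomorph.subLeft x))).comp_sub_left x
        simpa [mul_comm] using this
      simp only [potential_eq, ← integral_const_mul]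
      rw [← integral_finsetSum _ fun i _ => hint i]
      congr 1
      funext y
      rw [Finset.mul_sum, Finset.mul_sum]
      refine Finset.sum_congr rfl fun i _ => ?_
      rw [coulombGrad, PiLp.sub_apply]
      ring
    · intro i _
      refine Continuous.integrable_of_hasCompactSupport ?_ hc.mul_right
      exact hμ.continuous.mul ((hv i).continuous.mul
        (decays_potential_coulombGrad hd hμ.continuous hc i).1)
  have hE : (∫ x, ∫ y, μ x * μ y * ‖x - y‖ ^ (-((d : ℝ) - 2)))
      = ∫ x, μ x * potential coulomb μ x := by
    congr 1
    funext x
    rw [potential_eq, ← integral_const_mul]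
    simp only [coulomb, mul_assoc]
  have hmain := laplaceConst_mul_transport_le hd hμ hc hv hv0 hS
  rw [← laplaceConst_mul_energy hd hμ hc] at hmain
  rw [hT, hE]
  refine le_of_mul_le_mul_left (hmain.trans_eq ?_) (laplaceConst_pos hd)
  ring
end
end

section
/- Let d ≥ 3 and α ∈ (max(0, d-4), d-2), and let K(x) = |x|^{-α}. There exists a constant C > 0 depending only on α and d such that for every μ ∈ C_c^∞(ℝ^d;ℝ) and every u ∈ C_c^∞(ℝ^d;ℝ^d), T(μ,u) ≤ C ( ‖∇u‖_{L^∞} + ‖Δu‖_{L^d} ) E(μ), i.e. ∬ μ(x) μ(y) u(x)·∇K(x-y) dx dy ≤ C ( ‖∇u‖_{L^∞} + ‖Δu‖_{L^d} ) ∬ μ(x) μ(y) |x-y|^{-α} dx dy. -/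
open MeasureTheory

noncomputable section

/-- The componentwise Laplacian `Δu` of a vector field `u : ℝ^d → ℝ^d`. -/
noncomputable def vecLap (d : ℕ)
    (u : EuclideanSpace ℝ (Fin d) → EuclideanSpace ℝ (Fin d))
    (x : EuclideanSpace ℝ (Fin d)) : EuclideanSpace ℝ (Fin d) :=
  ∑ i : Fin d,
    fderiv ℝ (fun y => fderiv ℝ u y (EuclideanSpace.single i 1)) x
      (EuclideanSpace.single i 1)

open SchwartzMap FourierTransform LineDeriv Laplacian
open scoped ContDiff ENNReal NNReal Topology

section HeatSymbol

variable {V : Type*} [NormedAddCommGroup V]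

/-- The Fourier symbol `exp (-4 π² t |ξ|²)` of the heat semigroup at time `t`. -/
def heatSymbol (t : ℝ) (ξ : V) : ℝ := Real.exp (-(t * (2 * Real.pi * ‖ξ‖) ^ 2))

lemma heatSymbol_pos (t : ℝ) (ξ : V) : 0 < heatSymbol t ξ := Real.exp_pos _

lemma heatSymbol_le_one {t : ℝ} (ht : 0 ≤ t) (ξ : V) : heatSymbol t ξ ≤ 1 := by
  rw [heatSymbol, Real.exp_le_one_iff]
  have := mul_nonneg ht (sq_nonneg (2 * Real.pi * ‖ξ‖))
  linarith

lemma heatSymbol_add (s t : ℝ) (ξ : V) :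
    heatSymbol (s + t) ξ = heatSymbol s ξ * heatSymbol t ξ := by
  rw [heatSymbol, heatSymbol, heatSymbol, ← Real.exp_add]
  ring_nf

lemma heatSymbol_antitone (ξ : V) : Antitone fun t ↦ heatSymbol t ξ := by
  intro s t hst
  simp only [heatSymbol, Real.exp_le_exp, neg_le_neg_iff]
  gcongr

lemma continuous_heatSymbol (t : ℝ) : Continuous (heatSymbol t : V → ℝ) := by
  unfold heatSymbol
  fun_prop

lemma heatSymbol_hasTemperateGrowth [InnerProductSpace ℝ V] {t : ℝ} (ht : 0 ≤ t) :
    (heatSymbol t : V → ℝ).HasTemperateGrowth := by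
  have h : (heatSymbol t : V → ℝ) =
      (fun x : ℝ ↦ Real.exp (-x)) ∘ (fun ξ : V ↦ (t * (2 * Real.pi) ^ 2) * ‖ξ‖ ^ 2) := by
    ext ξ
    simp only [heatSymbol, Function.comp]
    ring_nf
  rw [h]
  have hsm : ContDiff ℝ ∞ (fun x : ℝ ↦ Real.exp (-x)) := Real.contDiff_exp.comp contDiff_neg
  refine Function.HasTemperateGrowth.comp' (t := Set.Ici 0) ?_ (uniqueDiffOn_Ici 0)
    hsm.contDiffOn ?_ ?_
  · rintro _ ⟨ξ, rfl⟩
    simp only [Set.mem_Ici]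
    positivity
  · refine fun N ↦ ⟨0, 1, zero_le_one, fun n _ x hx ↦ ?_⟩
    rw [norm_iteratedFDerivWithin_eq_norm_iteratedDerivWithin,
      iteratedDerivWithin_eq_iteratedDeriv (uniqueDiffOn_Ici 0)
        (hsm.contDiffAt.of_le (by exact_mod_cast le_top)) hx]
    have : (fun x : ℝ ↦ Real.exp (-x)) = fun x ↦ Real.exp ((-1) * x) := by simp
    rw [this, iteratedDeriv_exp_const_mul]
    simpa using hx
  · exact (Function.HasTemperateGrowth.const _).mul (Function.hasTemperateGrowth_norm_sq V)

lemma heatSymbol_ofReal_hasTemperateGrowth [InnerProductSpace ℝ V] {t : ℝ} (ht : 0 ≤ t) :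
    (fun ξ : V ↦ (heatSymbol t ξ : ℂ)).HasTemperateGrowth :=
  Function.Complex.hasTemperateGrowth_ofReal.comp (heatSymbol_hasTemperateGrowth ht)

lemma mul_heatSymbol_le {t : ℝ} (ht : 0 < t) (ξ : V) :
    (2 * Real.pi * ‖ξ‖) ^ 2 * heatSymbol t ξ ≤ 1 / t := by
  have h := Real.add_one_le_exp (t * (2 * Real.pi * ‖ξ‖) ^ 2)
  rw [heatSymbol, Real.exp_neg, ← div_eq_mul_inv, div_le_div_iff₀ (Real.exp_pos _) ht]
  linarith

end HeatSymbol

section Heat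

variable {V : Type*} [NormedAddCommGroup V] [InnerProductSpace ℝ V] [FiniteDimensional ℝ V]
  [MeasurableSpace V] [BorelSpace V]

/-- The heat semigroup on Schwartz functions. -/
def heat (t : ℝ) : 𝓢(V, ℂ) →L[ℂ] 𝓢(V, ℂ) :=
  fourierMultiplierCLM ℂ fun ξ ↦ (heatSymbol t ξ : ℂ)

lemma fourier_heat {t : ℝ} (ht : 0 ≤ t) (f : 𝓢(V, ℂ)) (ξ : V) :
    𝓕 (heat t f) ξ = heatSymbol t ξ * 𝓕 f ξ := by
  rw [heat, fourierMultiplierCLM_apply, fourier_fourierInv_eq,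
    smulLeftCLM_apply_apply (heatSymbol_ofReal_hasTemperateGrowth ht), smul_eq_mul]

lemma heat_zero (f : 𝓢(V, ℂ)) : heat 0 f = f := by
  have : (fun ξ : V ↦ (heatSymbol 0 ξ : ℂ)) = fun _ ↦ 1 := by simp [heatSymbol]
  rw [heat, this, fourierMultiplierCLM_const]
  simp

lemma fourier_lineDeriv_apply (f : 𝓢(V, ℂ)) (m ξ : V) :
    𝓕 (∂_{m} f) ξ = (2 * Real.pi * Complex.I) * (inner ℝ ξ m : ℝ) * 𝓕 f ξ := by
  have h : (fun ξ : V ↦ inner ℝ ξ m).HasTemperateGrowth :=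
    Function.hasTemperateGrowth_inner_left m
  rw [fourier_lineDerivOp_eq]
  simp [smulLeftCLM_apply_apply h, mul_assoc]

lemma schwartz_ext_fourier {f g : 𝓢(V, ℂ)} (h : ∀ ξ, 𝓕 f ξ = 𝓕 g ξ) : f = g := by
  have h' : 𝓕 f = 𝓕 g := by ext ξ; exact h ξ
  rw [← fourierInv_fourier_eq (F := 𝓢(V, ℂ)) f, h', fourierInv_fourier_eq]

lemma lineDeriv_heat {t : ℝ} (ht : 0 ≤ t) (f : 𝓢(V, ℂ)) (m : V) :
    ∂_{m} (heat t f) = heat t (∂_{m} f) := by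
  refine schwartz_ext_fourier fun ξ ↦ ?_
  simp only [fourier_lineDeriv_apply, fourier_heat ht]
  ring

lemma fourier_laplacian_apply (f : 𝓢(V, ℂ)) (ξ : V) :
    𝓕 (Δ f) ξ = -((2 * Real.pi * ‖ξ‖) ^ 2 : ℝ) * 𝓕 f ξ := by
  have h : ((‖·‖ ^ 2 : V → ℝ)).HasTemperateGrowth := by
    exact (Function.hasTemperateGrowth_norm_sq V)
  rw [laplacian_eq_fourierMultiplierCLM, fourier_smul, fourierMultiplierCLM_apply,
    fourier_fourierInv_eq, smul_apply, smulLeftCLM_apply_apply h]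
  simp
  ring

lemma laplacian_heat {t : ℝ} (ht : 0 ≤ t) (f : 𝓢(V, ℂ)) : Δ (heat t f) = heat t (Δ f) := by
  refine schwartz_ext_fourier fun ξ ↦ ?_
  simp only [fourier_laplacian_apply, fourier_heat ht]
  ring

lemma schwartz_apply_eq_integral (f : 𝓢(V, ℂ)) (x : V) :
    f x = ∫ ξ, Real.fourierChar (inner ℝ ξ x) • 𝓕 f ξ := by
  conv_lhs => rw [← fourierInv_fourier_eq (F := 𝓢(V, ℂ)) f]
  rw [fourierInv_coe, Real.fourierInv_eq]

lemma heat_apply_eq_integral {t : ℝ} (ht : 0 ≤ t) (f : 𝓢(V, ℂ)) (x : V) :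
    heat t f x =
      ∫ ξ, (Real.fourierChar (inner ℝ ξ x) : ℂ) * ((heatSymbol t ξ : ℂ) * 𝓕 f ξ) := by
  rw [schwartz_apply_eq_integral]
  simp only [fourier_heat ht, Circle.smul_def, smul_eq_mul]

lemma norm_fourierChar_mul_heatSymbol_mul_le {t : ℝ} (ht : 0 ≤ t) (f : 𝓢(V, ℂ)) (x ξ : V) :
    ‖(Real.fourierChar (inner ℝ ξ x) : ℂ) * ((heatSymbol t ξ : ℂ) * 𝓕 f ξ)‖ ≤ ‖𝓕 f ξ‖ := by
  rw [norm_mul, norm_mul, Circle.norm_coe, one_mul, Complex.norm_real,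
    Real.norm_of_nonneg (heatSymbol_pos t ξ).le]
  exact mul_le_of_le_one_left (norm_nonneg _) (heatSymbol_le_one ht ξ)

lemma aestronglyMeasurable_heat_integrand (t : ℝ) (f : 𝓢(V, ℂ)) (x : V) :
    AEStronglyMeasurable
      fun ξ ↦ (Real.fourierChar (inner ℝ ξ x) : ℂ) * ((heatSymbol t ξ : ℂ) * 𝓕 f ξ) := by
  have h : Continuous fun ξ : V ↦ (Real.fourierChar (inner ℝ ξ x) : ℂ) := by fun_prop
  exact Continuous.aestronglyMeasurable <| h.mul (
    (Complex.continuous_ofReal.comp (continuous_heatSymbol t)).mul (𝓕 f).continuous)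

lemma norm_heat_apply_le {t : ℝ} (ht : 0 ≤ t) (f : 𝓢(V, ℂ)) (x : V) :
    ‖heat t f x‖ ≤ ∫ ξ, ‖𝓕 f ξ‖ := by
  rw [heat_apply_eq_integral ht]
  exact norm_integral_le_of_norm_le (𝓕 f).integrable.norm
    (Filter.Eventually.of_forall fun ξ ↦ norm_fourierChar_mul_heatSymbol_mul_le ht f x ξ)

lemma continuousOn_heat_apply (f : 𝓢(V, ℂ)) (x : V) :
    ContinuousOn (fun t ↦ heat t f x) (Set.Ici 0) := by
  have h : ContinuousOn (fun t : ℝ ↦ ∫ ξ, (Real.fourierChar (inner ℝ ξ x) : ℂ) *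
      ((heatSymbol t ξ : ℂ) * 𝓕 f ξ)) (Set.Ici 0) := by
    refine continuousOn_of_dominated (bound := fun ξ ↦ ‖𝓕 f ξ‖)
      (fun t _ ↦ aestronglyMeasurable_heat_integrand t f x)
      (fun t ht ↦ Filter.Eventually.of_forall
        fun ξ ↦ norm_fourierChar_mul_heatSymbol_mul_le ht f x ξ)
      (𝓕 f).integrable.norm (Filter.Eventually.of_forall fun ξ ↦ Continuous.continuousOn ?_)
    unfold heatSymbol
    fun_prop
  exact h.congr fun t ht ↦ heat_apply_eq_integral ht f x

lemma hasDerivAt_heat_apply {t : ℝ} (ht : 0 < t) (f : 𝓢(V, ℂ)) (x : V) :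
    HasDerivAt (fun t ↦ heat t f x) (heat t (Δ f) x) t := by
  have key := hasDerivAt_integral_of_dominated_loc_of_deriv_le (μ := volume) (x₀ := t)
    (s := Set.Ioi 0) (bound := fun ξ : V ↦ ‖𝓕 (Δ f) ξ‖)
    (F := fun t ξ ↦ (Real.fourierChar (inner ℝ ξ x) : ℂ) * ((heatSymbol t ξ : ℂ) * 𝓕 f ξ))
    (F' := fun t ξ ↦ (Real.fourierChar (inner ℝ ξ x) : ℂ) * ((heatSymbol t ξ : ℂ) * 𝓕 (Δ f) ξ))
    (Ioi_mem_nhds ht)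
    (Filter.Eventually.of_forall fun t ↦ aestronglyMeasurable_heat_integrand t f x)
    ((𝓕 f).integrable.norm.mono' (aestronglyMeasurable_heat_integrand t f x)
      (Filter.Eventually.of_forall fun ξ ↦ norm_fourierChar_mul_heatSymbol_mul_le ht.le f x ξ))
    (aestronglyMeasurable_heat_integrand t (Δ f) x)
    (Filter.Eventually.of_forall fun ξ t ht ↦
      norm_fourierChar_mul_heatSymbol_mul_le (le_of_lt ht) (Δ f) x ξ)
    (𝓕 (Δ f)).integrable.norm
    (Filter.Eventually.of_forall fun ξ t _ ↦ ?_)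
  · rw [heat_apply_eq_integral ht.le]
    refine key.2.congr_of_eventuallyEq ?_
    filter_upwards [Ioi_mem_nhds ht] with r hr
    exact heat_apply_eq_integral (le_of_lt hr) f x
  · have h1 : HasDerivAt (fun r : ℝ ↦ heatSymbol r ξ)
        (heatSymbol t ξ * -((2 * Real.pi * ‖ξ‖) ^ 2)) t := by
      unfold heatSymbol
      simpa using (((hasDerivAt_id t).mul_const ((2 * Real.pi * ‖ξ‖) ^ 2)).neg).exp
    have h2 := ((h1.ofReal_comp.mul_const (𝓕 f ξ))).const_mul
      (Real.fourierChar (inner ℝ ξ x) : ℂ)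
    refine h2.congr_deriv ?_
    rw [fourier_laplacian_apply]
    push_cast
    ring

end Heat

section Energy

variable {V : Type*} [NormedAddCommGroup V] [InnerProductSpace ℝ V] [FiniteDimensional ℝ V]
  [MeasurableSpace V] [BorelSpace V]

/-- The squared `L²` norm of `heat t f`, written on the Fourier side. -/
def heatEnergy (f : 𝓢(V, ℂ)) (t : ℝ) : ℝ≥0∞ :=
  ∫⁻ ξ, ‖(heatSymbol t ξ : ℂ) * 𝓕 f ξ‖ₑ ^ 2

lemma heatEnergy_antitone (f : 𝓢(V, ℂ)) : Antitone (heatEnergy f) := by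
  intro s t hst
  refine lintegral_mono fun ξ ↦ ?_
  gcongr ?_ ^ 2
  rw [enorm_mul, enorm_mul]
  gcongr ?_ * _
  rw [enorm_le_iff_norm_le, Complex.norm_real, Complex.norm_real,
    Real.norm_of_nonneg (heatSymbol_pos _ _).le, Real.norm_of_nonneg (heatSymbol_pos _ _).le]
  exact heatSymbol_antitone ξ hst

lemma measurable_heatEnergy (f : 𝓢(V, ℂ)) : Measurable (heatEnergy f) :=
  (heatEnergy_antitone f).measurable

lemma eLpNorm_fourier_two (f : 𝓢(V, ℂ)) : eLpNorm (𝓕 f : 𝓢(V, ℂ)) 2 volume = eLpNorm f 2 volume := by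
  have h := norm_fourier_toL2_eq f
  rw [norm_toLp, norm_toLp] at h
  exact (ENNReal.toReal_eq_toReal_iff' (eLpNorm_lt_top _ _ _).ne (eLpNorm_lt_top _ _ _).ne).1 h

lemma eLpNorm_two_sq {α : Type*} [MeasurableSpace α] {μ : Measure α} {F : Type*}
    [NormedAddCommGroup F] (f : α → F) :
    eLpNorm f 2 μ ^ 2 = ∫⁻ x, ‖f x‖ₑ ^ 2 ∂μ := by
  rw [eLpNorm_eq_lintegral_rpow_enorm_toReal two_ne_zero ENNReal.ofNat_ne_top,
    ← ENNReal.rpow_natCast, ← ENNReal.rpow_mul]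
  simp

lemma sq_eLpNorm_heat {t : ℝ} (ht : 0 ≤ t) (f : 𝓢(V, ℂ)) :
    eLpNorm (heat t f) 2 volume ^ 2 = heatEnergy f t := by
  rw [← eLpNorm_fourier_two, eLpNorm_two_sq, heatEnergy]
  simp only [fourier_heat ht]

lemma heatEnergy_ne_top {t : ℝ} (ht : 0 ≤ t) (f : 𝓢(V, ℂ)) : heatEnergy f t ≠ ⊤ := by
  rw [← sq_eLpNorm_heat ht]
  exact ENNReal.pow_ne_top (eLpNorm_lt_top _ _ _).ne

lemma eLpNorm_lineDeriv_lineDeriv_heat_le {t : ℝ} (ht : 0 < t) (f : 𝓢(V, ℂ)) (m n : V) :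
    eLpNorm (∂_{m} (∂_{n} (heat t f)) : 𝓢(V, ℂ)) 2 volume ≤
      ENNReal.ofReal (‖m‖ * ‖n‖ * (2 / t)) * eLpNorm (heat (t / 2) f) 2 volume := by
  rw [← eLpNorm_fourier_two, ← eLpNorm_fourier_two (heat (t / 2) f)]
  refine eLpNorm_le_mul_eLpNorm_of_ae_le_mul (Filter.Eventually.of_forall fun ξ ↦ ?_) _
  have ht2 : 0 < t / 2 := by positivity
  simp only [fourier_lineDeriv_apply, fourier_heat ht.le, fourier_heat ht2.le, norm_mul,
    Complex.norm_real, Complex.norm_I, Real.norm_of_nonneg (heatSymbol_pos _ _).le,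
    Real.norm_of_nonneg Real.pi_pos.le, Complex.norm_ofNat, mul_one]
  have h1 : ‖inner ℝ ξ m‖ ≤ ‖ξ‖ * ‖m‖ := norm_inner_le_norm _ _
  have h2 : ‖inner ℝ ξ n‖ ≤ ‖ξ‖ * ‖n‖ := norm_inner_le_norm _ _
  have h3 : heatSymbol t ξ = heatSymbol (t / 2) ξ * heatSymbol (t / 2) ξ := by
    rw [← heatSymbol_add, add_halves]
  have h4 := mul_heatSymbol_le ht2 ξ
  have h5 := (heatSymbol_pos (t / 2) ξ).le
  rw [one_div_div] at h4
  calc 2 * Real.pi * ‖inner ℝ ξ m‖ * (2 * Real.pi * ‖inner ℝ ξ n‖ *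
        (heatSymbol t ξ * ‖𝓕 f ξ‖))
      ≤ 2 * Real.pi * (‖ξ‖ * ‖m‖) * (2 * Real.pi * (‖ξ‖ * ‖n‖) *
        (heatSymbol t ξ * ‖𝓕 f ξ‖)) := by
        have := Real.pi_pos
        have := (heatSymbol_pos t ξ).le
        gcongr
    _ = ‖m‖ * ‖n‖ * ((2 * Real.pi * ‖ξ‖) ^ 2 * heatSymbol (t / 2) ξ) *
        (heatSymbol (t / 2) ξ * ‖𝓕 f ξ‖) := by rw [h3]; ring
    _ ≤ _ := by gcongr

lemma integral_mul_heat_two_mul {f : 𝓢(V, ℂ)} (hf : ∀ x, starRingEnd ℂ (f x) = f x) {s : ℝ}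
    (hs : 0 ≤ s) :
    ∫ x, f x * heat (2 * s) f x = ((heatEnergy f s).toReal : ℂ) := by
  have h1 : ∫ x, f x * heat (2 * s) f x = ∫ x, inner ℂ (f x) (heat (2 * s) f x) := by
    refine integral_congr_ae (Filter.Eventually.of_forall fun x ↦ ?_)
    simp only [RCLike.inner_apply, hf, mul_comm]
  have hh : heatEnergy f s = ∫⁻ ξ, ENNReal.ofReal (heatSymbol (2 * s) ξ * ‖𝓕 f ξ‖ ^ 2) := by
    refine lintegral_congr fun ξ ↦ ?_
    rw [← ofReal_norm, ← ENNReal.ofReal_pow (norm_nonneg _), norm_mul, Complex.norm_real,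
      Real.norm_of_nonneg (heatSymbol_pos _ _).le, two_mul, heatSymbol_add]
    ring_nf
  rw [h1, ← integral_inner_fourier_fourier, hh, ← integral_eq_lintegral_of_nonneg_ae,
    ← integral_complex_ofReal]
  · refine integral_congr_ae (Filter.Eventually.of_forall fun ξ ↦ ?_)
    have h2s : 0 ≤ 2 * s := by positivity
    simp only [fourier_heat h2s, RCLike.inner_apply, mul_assoc, Complex.mul_conj,
      Complex.normSq_eq_norm_sq]
    push_cast
    ring
  · exact Filter.Eventually.of_forall fun ξ ↦
      mul_nonneg (heatSymbol_pos _ _).le (sq_nonneg _)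
  · exact ((continuous_heatSymbol _).mul
      ((𝓕 f).continuous.norm.pow 2)).aestronglyMeasurable

end Energy

section Commutator

variable {V : Type*} [NormedAddCommGroup V] [InnerProductSpace ℝ V]

/-- The pointwise product of two Schwartz functions. -/
def schwartzMul (f g : 𝓢(V, ℂ)) : 𝓢(V, ℂ) := pairing (ContinuousLinearMap.mul ℂ ℂ) f g

lemma schwartzMul_apply (f g : 𝓢(V, ℂ)) (x : V) : schwartzMul f g x = f x * g x := by
  simp [schwartzMul, pairing_apply_apply]

lemma coe_schwartzMul (f g : 𝓢(V, ℂ)) : (schwartzMul f g : V → ℂ) = fun x ↦ f x * g x :=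
  funext (schwartzMul_apply f g)

lemma lineDeriv_schwartzMul (f g : 𝓢(V, ℂ)) (m : V) :
    ∂_{m} (schwartzMul f g) = schwartzMul (∂_{m} f) g + schwartzMul f (∂_{m} g) := by
  ext x
  have h : (schwartzMul f g : V → ℂ) = f * g := coe_schwartzMul f g
  rw [add_apply, schwartzMul_apply, schwartzMul_apply, lineDerivOp_apply_eq_fderiv, h,
    fderiv_mul f.differentiableAt g.differentiableAt, lineDerivOp_apply_eq_fderiv,
    lineDerivOp_apply_eq_fderiv]
  simp
  ring

variable [FiniteDimensional ℝ V]

lemma laplacian_schwartzMul_apply {ι : Type*} [Fintype ι] (b : OrthonormalBasis ι ℝ V)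
    (f g : 𝓢(V, ℂ)) (x : V) :
    Δ (schwartzMul f g) x =
      Δ f x * g x + 2 * ∑ i, (∂_{b i} f) x * (∂_{b i} g) x + f x * Δ g x := by
  simp only [laplacian_eq_sum b, lineDeriv_schwartzMul, lineDerivOp_add, sum_apply, add_apply,
    schwartzMul_apply, Finset.mul_sum, Finset.sum_mul, ← Finset.sum_add_distrib]
  refine Finset.sum_congr rfl fun i _ ↦ ?_
  ring

variable [MeasurableSpace V] [BorelSpace V]

lemma integral_mul_mul_lineDeriv_self (v f : 𝓢(V, ℂ)) (m : V) :
    ∫ x, f x * (v x * ∂_{m} f x) = -(1 / 2) * ∫ x, ∂_{m} v x * (f x * f x) := by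
  have h := integral_mul_lineDerivOp_right_eq_neg_left (μ := volume) (schwartzMul v f) f m
  simp only [lineDeriv_schwartzMul, add_apply, schwartzMul_apply, add_mul] at h
  have i1 : Integrable fun x ↦ ∂_{m} v x * f x * f x := by
    simpa only [coe_schwartzMul] using
      (schwartzMul (schwartzMul (∂_{m} v) f) f).integrable (μ := volume)
  have i2 : Integrable fun x ↦ v x * ∂_{m} f x * f x := by
    simpa only [coe_schwartzMul] using
      (schwartzMul (schwartzMul v (∂_{m} f)) f).integrable (μ := volume)
  rw [integral_add i1 i2] at h
  have e1 : ∫ x, v x * f x * ∂_{m} f x = ∫ x, f x * (v x * ∂_{m} f x) := by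
    congr 1; ext x; ring
  have e2 : ∫ x, v x * ∂_{m} f x * f x = ∫ x, f x * (v x * ∂_{m} f x) := by
    congr 1; ext x; ring
  have e3 : ∫ x, ∂_{m} v x * f x * f x = ∫ x, ∂_{m} v x * (f x * f x) := by
    congr 1; ext x; ring
  rw [e1, e2, e3] at h
  linear_combination (1 / 2) * h

lemma integral_laplacian_commutator {ι : Type*} [Fintype ι] (b : OrthonormalBasis ι ℝ V)
    (v F G : 𝓢(V, ℂ)) :
    ∫ x, (F x * (v x * Δ G x) - Δ F x * (v x * G x)) =
      -∫ x, F x * (Δ v x * G x + 2 * ∑ i, (∂_{b i} v) x * (∂_{b i} G) x) := by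
  have h := integral_mul_laplacian_right_eq_left (μ := volume) F (schwartzMul v G)
  have i1 : Integrable fun x ↦ F x * (v x * Δ G x) := by
    simpa only [coe_schwartzMul] using
      (schwartzMul F (schwartzMul v (Δ G))).integrable (μ := volume)
  have i2 : Integrable fun x ↦ Δ F x * (v x * G x) := by
    simpa only [coe_schwartzMul] using
      (schwartzMul (Δ F) (schwartzMul v G)).integrable (μ := volume)
  have i3 : Integrable fun x ↦ F x * Δ (schwartzMul v G) x := by
    simpa only [coe_schwartzMul] using
      (schwartzMul F (Δ (schwartzMul v G))).integrable (μ := volume)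
  simp only [schwartzMul_apply v G] at h
  rw [integral_sub i1 i2, ← h, ← integral_sub i1 i3, ← integral_neg]
  refine integral_congr_ae (Filter.Eventually.of_forall fun x ↦ ?_)
  simp only [laplacian_schwartzMul_apply b]
  ring

lemma continuousOn_integral_heat_mul (v f g : 𝓢(V, ℂ)) {s : ℝ} (hs : 0 ≤ s) :
    ContinuousOn (fun r ↦ ∫ x, heat (s - r) f x * (v x * heat (s + r) g x)) (Set.Icc 0 s) := by
  refine continuousOn_of_dominated
    (bound := fun x ↦ (∫ ξ, ‖𝓕 f ξ‖) * (‖v x‖ * ∫ ξ, ‖𝓕 g ξ‖)) (fun r _ ↦ ?_) (fun r hr ↦ ?_) ?_ ?_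
  · exact ((heat (s - r) f).continuous.mul
      (v.continuous.mul (heat (s + r) g).continuous)).aestronglyMeasurable
  · refine Filter.Eventually.of_forall fun x ↦ ?_
    rw [norm_mul, norm_mul]
    have h1 : 0 ≤ s - r := by linarith [hr.2]
    have h2 : 0 ≤ s + r := by linarith [hr.1]
    have h3 := norm_heat_apply_le h1 f x
    have h4 := norm_heat_apply_le h2 g x
    gcongr
  · exact (v.integrable.norm.mul_const _).const_mul _
  · refine Filter.Eventually.of_forall fun x ↦ ContinuousOn.mul ?_ (continuousOn_const.mul ?_)
    · exact (continuousOn_heat_apply f x).comp (by fun_prop) fun r hr ↦ by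
        simp only [Set.mem_Ici]; linarith [hr.2]
    · exact (continuousOn_heat_apply g x).comp (by fun_prop) fun r hr ↦ by
        simp only [Set.mem_Ici]; linarith [hr.1]

lemma hasDerivAt_integral_heat_mul (v f g : 𝓢(V, ℂ)) {s r : ℝ} (hr : r ∈ Set.Ioo 0 s) :
    HasDerivAt (fun r ↦ ∫ x, heat (s - r) f x * (v x * heat (s + r) g x))
      (∫ x, (heat (s - r) f x * (v x * heat (s + r) (Δ g) x) -
        heat (s - r) (Δ f) x * (v x * heat (s + r) g x))) r := by
  refine (hasDerivAt_integral_of_dominated_loc_of_deriv_le (s := Set.Ioo 0 s)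
    (bound := fun x ↦ (∫ ξ, ‖𝓕 f ξ‖) * (‖v x‖ * ∫ ξ, ‖𝓕 (Δ g) ξ‖) +
      (∫ ξ, ‖𝓕 (Δ f) ξ‖) * (‖v x‖ * ∫ ξ, ‖𝓕 g ξ‖))
    (F' := fun r x ↦ heat (s - r) f x * (v x * heat (s + r) (Δ g) x) -
        heat (s - r) (Δ f) x * (v x * heat (s + r) g x))
    (isOpen_Ioo.mem_nhds hr) ?_ ?_ ?_ ?_ ?_ ?_).2
  · exact Filter.Eventually.of_forall fun r ↦ ((heat (s - r) f).continuous.mul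
      (v.continuous.mul (heat (s + r) g).continuous)).aestronglyMeasurable
  · simpa only [coe_schwartzMul] using
      (schwartzMul (heat (s - r) f) (schwartzMul v (heat (s + r) g))).integrable (μ := volume)
  · exact (((heat (s - r) f).continuous.mul
      (v.continuous.mul (heat (s + r) (Δ g)).continuous)).sub ((heat (s - r) (Δ f)).continuous.mul
      (v.continuous.mul (heat (s + r) g).continuous))).aestronglyMeasurable
  · refine Filter.Eventually.of_forall fun x r hr ↦ (norm_sub_le _ _).trans ?_
    simp only [norm_mul]
    have h1 : 0 ≤ s - r := by linarith [hr.2]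
    have h2 : 0 ≤ s + r := by linarith [hr.1, hr.2]
    have h3 := norm_heat_apply_le h1 f x
    have h4 := norm_heat_apply_le h2 g x
    have h5 := norm_heat_apply_le h1 (Δ f) x
    have h6 := norm_heat_apply_le h2 (Δ g) x
    gcongr
  · exact ((v.integrable.norm.mul_const _).const_mul _).add
      ((v.integrable.norm.mul_const _).const_mul _)
  · refine Filter.Eventually.of_forall fun x r hr ↦ ?_
    have h1 : 0 < s - r := by linarith [hr.2]
    have h2 : 0 < s + r := by linarith [hr.1, hr.2]
    have d1 := (hasDerivAt_heat_apply h1 f x).scomp r ((hasDerivAt_id r).const_sub s)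
    have d2 := (hasDerivAt_heat_apply h2 g x).scomp r ((hasDerivAt_id r).const_add s)
    refine (d1.mul (d2.const_mul (v x))).congr_deriv ?_
    simp
    ring

end Commutator

section Sobolev

variable {V : Type*} [NormedAddCommGroup V] [InnerProductSpace ℝ V]

lemma norm_clm_le_sum_basis {ι : Type*} [Fintype ι] (b : OrthonormalBasis ι ℝ V)
    {F : Type*} [NormedAddCommGroup F] [NormedSpace ℝ F] (A : V →L[ℝ] F) :
    ‖A‖ ≤ ∑ i, ‖A (b i)‖ := by
  refine A.opNorm_le_bound (Finset.sum_nonneg fun _ _ ↦ norm_nonneg _) fun v ↦ ?_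
  conv_lhs => rw [← b.sum_repr v, map_sum]
  refine (norm_sum_le _ _).trans ?_
  rw [Finset.sum_mul]
  refine Finset.sum_le_sum fun i _ ↦ ?_
  rw [map_smul, norm_smul, mul_comm]
  gcongr
  rw [← b.repr.norm_map v]
  exact PiLp.norm_apply_le _ i

variable [FiniteDimensional ℝ V]

/-- Cut-offs growing to `1` with gradients decaying to `0`. -/
lemma exists_cutoff_sequence : ∃ (χ : ℕ → V → ℝ) (K : ℝ), 0 ≤ K ∧
    (∀ n, ContDiff ℝ ∞ (χ n)) ∧ (∀ n, HasCompactSupport (χ n)) ∧ (∀ n x, |χ n x| ≤ 1) ∧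
    (∀ n x, ‖fderiv ℝ (χ n) x‖ ≤ K / (n + 1)) ∧
    ∀ x, Filter.Tendsto (fun n ↦ χ n x) Filter.atTop (𝓝 1) := by
  let φ : ContDiffBump (0 : V) := ⟨1, 2, by norm_num, by norm_num⟩
  have hφ : ContDiff ℝ ∞ φ := φ.contDiff
  obtain ⟨K, hK⟩ := (hφ.continuous_fderiv (by simp)).bounded_above_of_compact_support
    (φ.hasCompactSupport.fderiv (𝕜 := ℝ))
  have hpos : ∀ n : ℕ, (0 : ℝ) < ((n : ℝ) + 1)⁻¹ := fun n ↦ by positivity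
  refine ⟨fun n x ↦ φ ((n + 1 : ℝ)⁻¹ • x), K, (norm_nonneg _).trans (hK 0), fun n ↦ ?_,
    fun n ↦ ?_, fun n x ↦ ?_, fun n x ↦ ?_, fun x ↦ ?_⟩
  · exact hφ.comp (contDiff_const_smul _)
  · exact φ.hasCompactSupport.comp_smul (hpos n).ne'
  · rw [abs_of_nonneg φ.nonneg]
    exact φ.le_one
  · rw [fderiv_comp_smul, norm_smul, Real.norm_of_nonneg (hpos n).le, div_eq_inv_mul]
    exact mul_le_mul_of_nonneg_left (hK _) (hpos n).le
  · have h0 : Filter.Tendsto (fun n : ℕ ↦ ((n : ℝ) + 1)⁻¹ • x) Filter.atTop (𝓝 0) := by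
      simpa using (tendsto_one_div_add_atTop_nhds_zero_nat (𝕜 := ℝ)).smul_const x
    have h1 := (hφ.continuous.tendsto 0).comp h0
    rwa [φ.one_of_mem_closedBall (by simp [φ])] at h1

variable [MeasurableSpace V] [BorelSpace V]

lemma eLpNorm_fderiv_smul_le (f : 𝓢(V, ℂ)) {χ : V → ℝ} (hχ : ContDiff ℝ ∞ χ)
    (hχ1 : ∀ x, |χ x| ≤ 1) {δ : ℝ} (hδ : ∀ x, ‖fderiv ℝ χ x‖ ≤ δ) :
    eLpNorm (fderiv ℝ fun x ↦ χ x • f x) 2 volume ≤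
      eLpNorm (fderiv ℝ f) 2 volume + ENNReal.ofReal δ * eLpNorm f 2 volume := by
  have hfd : Continuous (fderiv ℝ f) := (f.smooth ⊤).continuous_fderiv (by simp)
  have hδ0 : 0 ≤ δ := (norm_nonneg _).trans (hδ 0)
  calc eLpNorm (fderiv ℝ fun x ↦ χ x • f x) 2 volume
      ≤ eLpNorm ((fun x ↦ ‖fderiv ℝ f x‖) + δ • fun x ↦ ‖f x‖) 2 volume := by
        refine eLpNorm_mono_real fun x ↦ ?_
        rw [fderiv_fun_smul (hχ.differentiable (by simp) x) f.differentiableAt]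
        refine (norm_add_le _ _).trans ?_
        simp only [Pi.add_apply, Pi.smul_apply, smul_eq_mul]
        refine add_le_add ?_ ?_
        · rw [norm_smul]
          exact mul_le_of_le_one_left (norm_nonneg _) (hχ1 x)
        · rw [ContinuousLinearMap.norm_smulRight_apply]
          exact mul_le_mul_of_nonneg_right (hδ x) (norm_nonneg _)
    _ ≤ eLpNorm (fun x ↦ ‖fderiv ℝ f x‖) 2 volume + eLpNorm (δ • fun x ↦ ‖f x‖) 2 volume :=
        eLpNorm_add_le hfd.norm.aestronglyMeasurable
          (f.continuous.norm.aestronglyMeasurable.const_smul _) (by norm_num)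
    _ = _ := by
        rw [eLpNorm_const_smul, eLpNorm_norm, eLpNorm_norm, Real.enorm_of_nonneg hδ0]

/-- The Gagliardo–Nirenberg–Sobolev inequality for Schwartz functions. -/
lemma eLpNorm_schwartz_le_eLpNorm_fderiv {p : ℝ≥0} (hn : 0 < Module.finrank ℝ V)
    (hp : (p : ℝ)⁻¹ = 2⁻¹ - (Module.finrank ℝ V : ℝ)⁻¹) (f : 𝓢(V, ℂ)) :
    eLpNorm f p volume ≤
      eLpNormLESNormFDerivOfEqInnerConst (volume : Measure V) 2 *
        eLpNorm (fderiv ℝ f) 2 volume := by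
  obtain ⟨χ, K, hK, hχ, hχc, hχ1, hχd, hχt⟩ := exists_cutoff_sequence (V := V)
  set C : ℝ≥0 := eLpNormLESNormFDerivOfEqInnerConst (volume : Measure V) 2 with hC
  have hf : ContDiff ℝ ∞ f := f.smooth ⊤
  have hbd (n : ℕ) : eLpNorm (fun x ↦ χ n x • f x) p volume ≤
      C * (eLpNorm (fderiv ℝ f) 2 volume +
        ENNReal.ofReal (K / (n + 1)) * eLpNorm f 2 volume) :=
    (eLpNorm_le_eLpNorm_fderiv_of_eq_inner volume (p := 2)
      (((hχ n).smul hf).of_le (by simp)) ((hχc n).smul_right) (by norm_num) hn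
      (by simpa using hp)).trans
      (mul_le_mul' le_rfl (eLpNorm_fderiv_smul_le f (hχ n) (hχ1 n) (hχd n)))
  have hlim : Filter.Tendsto (fun n : ℕ ↦ (C : ℝ≥0∞) * (eLpNorm (fderiv ℝ f) 2 volume +
      ENNReal.ofReal (K / (n + 1)) * eLpNorm f 2 volume)) Filter.atTop
      (𝓝 (C * (eLpNorm (fderiv ℝ f) 2 volume + ENNReal.ofReal 0 * eLpNorm f 2 volume))) := by
    have h0 : Filter.Tendsto (fun n : ℕ ↦ K / ((n : ℝ) + 1)) Filter.atTop (𝓝 0) := by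
      simpa [div_eq_mul_inv] using
        (tendsto_one_div_add_atTop_nhds_zero_nat (𝕜 := ℝ)).const_mul K
    have h1 : eLpNorm f 2 volume ≠ ⊤ := (f.memLp 2 volume).2.ne
    have h2 := ENNReal.Tendsto.mul_const (ENNReal.tendsto_ofReal h0) (Or.inr h1)
    exact ENNReal.Tendsto.const_mul (tendsto_const_nhds.add h2) (Or.inr ENNReal.coe_ne_top)
  refine (Lp.eLpNorm_lim_le_liminf_eLpNorm (f := fun n x ↦ χ n x • f x)
    (fun n ↦ ((hχ n).continuous.smul f.continuous).aestronglyMeasurable) f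
    (Filter.Eventually.of_forall fun x ↦ by simpa using (hχt x).smul_const (f x))).trans ?_
  refine (Filter.liminf_le_liminf (Filter.Eventually.of_forall hbd)).trans ?_
  rw [hlim.liminf_eq, ENNReal.ofReal_zero, zero_mul, add_zero]

lemma eLpNorm_schwartz_le_sum_lineDeriv {ι : Type*} [Fintype ι] (b : OrthonormalBasis ι ℝ V)
    {p : ℝ≥0} (hn : 0 < Module.finrank ℝ V)
    (hp : (p : ℝ)⁻¹ = 2⁻¹ - (Module.finrank ℝ V : ℝ)⁻¹) (f : 𝓢(V, ℂ)) :
    eLpNorm f p volume ≤ eLpNormLESNormFDerivOfEqInnerConst (volume : Measure V) 2 *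
        ∑ i, eLpNorm (∂_{b i} f : 𝓢(V, ℂ)) 2 volume := by
  refine (eLpNorm_schwartz_le_eLpNorm_fderiv hn hp f).trans ?_
  gcongr
  refine (eLpNorm_mono_real (g := ∑ i, fun x ↦ ‖∂_{b i} f x‖) fun x ↦ ?_).trans ?_
  · simpa [lineDerivOp_apply_eq_fderiv] using norm_clm_le_sum_basis b (fderiv ℝ f x)
  · refine (eLpNorm_sum_le (fun i _ ↦
      (∂_{b i} f).continuous.norm.aestronglyMeasurable) (by norm_num)).trans ?_
    simp only [eLpNorm_norm, le_refl]

end Sobolev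

section TransportBound

variable {V : Type*} [NormedAddCommGroup V] [InnerProductSpace ℝ V] [FiniteDimensional ℝ V]
  [MeasurableSpace V] [BorelSpace V]

lemma enorm_integral_mul_mul_le (F w G : 𝓢(V, ℂ)) (q p : ℝ≥0∞) [ENNReal.HolderTriple q p 2] :
    ‖∫ x, F x * (w x * G x)‖ₑ ≤
      eLpNorm F 2 volume * (eLpNorm w q volume * eLpNorm G p volume) := by
  have h1 : eLpNorm (fun x ↦ w x * G x) 2 volume ≤ eLpNorm w q volume * eLpNorm G p volume :=
    eLpNorm_smul_le_mul_eLpNorm (φ := w) (f := G) G.continuous.aestronglyMeasurable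
      w.continuous.aestronglyMeasurable
  refine (enorm_integral_le_lintegral_enorm _).trans ?_
  rw [← eLpNorm_one_eq_lintegral_enorm]
  refine (eLpNorm_smul_le_mul_eLpNorm (p := 2) (q := 2) (r := 1) (φ := F) (f := fun x ↦ w x * G x)
    (w.continuous.mul G.continuous).aestronglyMeasurable
      F.continuous.aestronglyMeasurable).trans ?_
  gcongr

lemma eLpNorm_heat_antitone (f : 𝓢(V, ℂ)) {s t : ℝ} (hs : 0 ≤ s) (hst : s ≤ t) :
    eLpNorm (heat t f) 2 volume ≤ eLpNorm (heat s f) 2 volume := by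
  have h := heatEnergy_antitone f hst
  rw [← sq_eLpNorm_heat hs, ← sq_eLpNorm_heat (hs.trans hst)] at h
  exact (ENNReal.pow_le_pow_left_iff two_ne_zero).1 h

variable {ι : Type*} [Fintype ι]

/-- The quantity controlling a scalar component of the transporting field. -/
def transportNorm (b : OrthonormalBasis ι ℝ V) (v : 𝓢(V, ℂ)) : ℝ≥0∞ :=
  ∑ i, eLpNorm (∂_{b i} v : 𝓢(V, ℂ)) ⊤ volume +
    eLpNorm (Δ v : 𝓢(V, ℂ)) (Module.finrank ℝ V) volume

/-- The constant in `enorm_integral_laplacian_commutator_le`. -/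
def transportConst (ι V : Type*) [Fintype ι] [NormedAddCommGroup V] [InnerProductSpace ℝ V]
    [FiniteDimensional ℝ V] [MeasurableSpace V] [BorelSpace V] : ℝ≥0∞ :=
  eLpNormLESNormFDerivOfEqInnerConst (volume : Measure V) 2 * Fintype.card ι + 2

lemma transportConst_ne_top : transportConst ι V ≠ ⊤ := by
  simp [transportConst, ENNReal.mul_eq_top]

lemma enorm_integral_laplacian_commutator_le (b : OrthonormalBasis ι ℝ V)
    (hn : 2 < Module.finrank ℝ V) (v F G : 𝓢(V, ℂ)) {A : ℝ≥0∞}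
    (hA : ∀ i, eLpNorm (∂_{b i} G : 𝓢(V, ℂ)) 2 volume ≤ A) :
    ‖∫ x, (F x * (v x * Δ G x) - Δ F x * (v x * G x))‖ₑ ≤
      transportConst ι V * transportNorm b v * (eLpNorm F 2 volume * A) := by
  set C := eLpNormLESNormFDerivOfEqInnerConst (volume : Measure V) 2 with hC
  set n := Module.finrank ℝ V with hn'
  have hn0 : (2 : ℝ) < n := by exact_mod_cast hn
  have hpos : 0 < (2 : ℝ)⁻¹ - (n : ℝ)⁻¹ := by
    have := inv_strictAnti₀ (by norm_num) hn0
    linarith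
  obtain ⟨p, hp⟩ : ∃ p : ℝ≥0, (p : ℝ) = ((2 : ℝ)⁻¹ - (n : ℝ)⁻¹)⁻¹ :=
    ⟨⟨((2 : ℝ)⁻¹ - (n : ℝ)⁻¹)⁻¹, by positivity⟩, rfl⟩
  have hp1 : (p : ℝ)⁻¹ = 2⁻¹ - (n : ℝ)⁻¹ := by rw [hp, inv_inv]
  have hp0 : p ≠ 0 := by
    rw [← NNReal.coe_ne_zero, hp]
    exact (inv_pos.2 hpos).ne'
  have htri : ENNReal.HolderTriple (n : ℝ≥0∞) p 2 := by
    constructor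
    have hn1 : (n : ℝ≥0) ≠ 0 := by simp; omega
    have h2 : (n : ℝ≥0)⁻¹ + p⁻¹ = 2⁻¹ := by
      apply NNReal.coe_injective
      push_cast
      rw [hp1]
      ring
    have h3 : ((n : ℝ≥0) : ℝ≥0∞)⁻¹ + (p : ℝ≥0∞)⁻¹ = ((2 : ℝ≥0) : ℝ≥0∞)⁻¹ := by
      rw [← ENNReal.coe_inv hn1, ← ENNReal.coe_inv hp0, ← ENNReal.coe_inv two_ne_zero,
        ← ENNReal.coe_add, h2]
    simpa using h3
  have hG : eLpNorm G p volume ≤ C * (Fintype.card ι * A) := by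
    refine (eLpNorm_schwartz_le_sum_lineDeriv b (by omega) hp1 G).trans ?_
    gcongr
    refine (Finset.sum_le_sum fun i _ ↦ hA i).trans ?_
    simp
  have i0 : Integrable fun x ↦ F x * (Δ v x * G x) := by
    simpa only [coe_schwartzMul] using
      (schwartzMul F (schwartzMul (Δ v) G)).integrable (μ := volume)
  have ii (i : ι) : Integrable fun x ↦ F x * (∂_{b i} v x * ∂_{b i} G x) := by
    simpa only [coe_schwartzMul] using
      (schwartzMul F (schwartzMul (∂_{b i} v) (∂_{b i} G))).integrable (μ := volume)
  have e : ∫ x, F x * (Δ v x * G x + 2 * ∑ i, (∂_{b i} v) x * (∂_{b i} G) x) =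
      (∫ x, F x * (Δ v x * G x)) + 2 * ∑ i, ∫ x, F x * (∂_{b i} v x * ∂_{b i} G x) := by
    rw [← integral_finsetSum _ fun i _ ↦ ii i, ← integral_const_mul,
      ← integral_add i0 ((integrable_finsetSum _ fun i _ ↦ ii i).const_mul 2)]
    congr 1
    ext x
    rw [mul_add, Finset.mul_sum, Finset.mul_sum, Finset.mul_sum]
    congr 1
    refine Finset.sum_congr rfl fun i _ ↦ ?_
    ring
  rw [integral_laplacian_commutator b, enorm_neg, e]
  have h1 : ‖∫ x, F x * (Δ v x * G x)‖ₑ ≤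
      eLpNorm F 2 volume * (eLpNorm (Δ v : 𝓢(V, ℂ)) n volume * (C * (Fintype.card ι * A))) :=
    (enorm_integral_mul_mul_le F (Δ v) G n p).trans (by gcongr)
  have h2 : ‖∑ i, ∫ x, F x * (∂_{b i} v x * ∂_{b i} G x)‖ₑ ≤
      ∑ i, eLpNorm F 2 volume * (eLpNorm (∂_{b i} v : 𝓢(V, ℂ)) ⊤ volume * A) := by
    refine (enorm_sum_le _ _).trans (Finset.sum_le_sum fun i _ ↦ ?_)
    refine (enorm_integral_mul_mul_le F (∂_{b i} v) (∂_{b i} G) ⊤ 2).trans ?_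
    have := hA i
    gcongr
  refine (enorm_add_le _ _).trans ?_
  rw [enorm_mul, show ‖(2 : ℂ)‖ₑ = 2 by simp [enorm]]
  refine (add_le_add h1 (mul_le_mul' le_rfl h2)).trans ?_
  rw [← Finset.mul_sum, ← Finset.sum_mul, transportConst, transportNorm, ← hC, ← hn']
  set S := ∑ i, eLpNorm (∂_{b i} v : 𝓢(V, ℂ)) ⊤ volume
  set L := eLpNorm (Δ v : 𝓢(V, ℂ)) n volume
  calc _ = (C * Fintype.card ι * L + 2 * S) * (eLpNorm F 2 volume * A) := by ring
    _ ≤ _ := by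
      gcongr
      calc _ ≤ (C * Fintype.card ι * L + 2 * S) + (C * Fintype.card ι * S + 2 * L) := le_self_add
        _ = _ := by ring

lemma lintegral_Ioo_comp_sub {s : ℝ} (hs : 0 < s) (g : ℝ → ℝ≥0∞) :
    ∫⁻ r in Set.Ioo 0 s, g (s - r) = ENNReal.ofReal s * ∫⁻ θ in Set.Ioo (0 : ℝ) 1, g (s * θ) := by
  have himg : (fun θ : ℝ ↦ s - s * θ) '' Set.Ioo 0 1 = Set.Ioo 0 s := by
    ext r
    constructor
    · rintro ⟨θ, ⟨h0, h1⟩, rfl⟩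
      constructor <;> nlinarith
    · rintro ⟨h0, h1⟩
      refine ⟨1 - r / s, ⟨?_, ?_⟩, ?_⟩
      · rw [sub_pos, div_lt_one hs]; exact h1
      · have := div_pos h0 hs; linarith
      · field_simp; ring
  rw [← himg, lintegral_image_eq_lintegral_abs_deriv_mul measurableSet_Ioo (f' := fun _ ↦ -s)
    (fun x _ ↦ by simpa using (((hasDerivAt_id x).const_mul s).const_sub s).hasDerivWithinAt)
    (fun x _ y _ h ↦ by simpa [hs.ne'] using h)]
  simp only [abs_neg, abs_of_pos hs, sub_sub_cancel]
  exact lintegral_const_mul' _ _ ENNReal.ofReal_ne_top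

end TransportBound

section TransportTime

lemma ENNReal.two_mul_mul_le_rpow {a b : ℝ≥0∞} (ha : a ≠ ⊤) (hb : b ≠ ⊤) {θ : ℝ} (hθ : 0 < θ)
    (β : ℝ) : 2 * (a * b) ≤ ENNReal.ofReal (θ ^ (-β)) * a ^ 2 + ENNReal.ofReal (θ ^ β) * b ^ 2 := by
  lift a to ℝ≥0 using ha
  lift b to ℝ≥0 using hb
  have h1 : (0 : ℝ) ≤ θ ^ (-β) := by positivity
  have h2 : (0 : ℝ) ≤ θ ^ β := by positivity
  have h3 : θ ^ (-β) * θ ^ β = 1 := by rw [← Real.rpow_add hθ]; simp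
  rw [← ENNReal.toReal_le_toReal (by finiteness) (by finiteness),
    ENNReal.toReal_add (by finiteness) (by finiteness)]
  simp only [ENNReal.toReal_mul, ENNReal.toReal_ofReal h1, ENNReal.toReal_ofReal h2,
    ENNReal.toReal_pow, ENNReal.coe_toReal, ENNReal.toReal_ofNat]
  have e1 : (θ ^ (-(β / 2))) ^ 2 = θ ^ (-β) := by
    rw [← Real.rpow_natCast, ← Real.rpow_mul hθ.le]; congr 1; push_cast; ring
  have e2 : (θ ^ (β / 2)) ^ 2 = θ ^ β := by
    rw [← Real.rpow_natCast, ← Real.rpow_mul hθ.le]; congr 1; push_cast; ring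
  have e3 : θ ^ (-(β / 2)) * θ ^ (β / 2) = 1 := by rw [← Real.rpow_add hθ]; simp
  rw [← e1, ← e2]
  calc 2 * ((a : ℝ) * b) = 2 * (θ ^ (-(β / 2)) * a) * (θ ^ (β / 2) * b) := by
        linear_combination -2 * (a : ℝ) * b * e3
    _ ≤ (θ ^ (-(β / 2)) * a) ^ 2 + (θ ^ (β / 2) * b) ^ 2 := two_mul_le_add_sq _ _
    _ = _ := by ring

variable {V : Type*} [NormedAddCommGroup V] [InnerProductSpace ℝ V] [FiniteDimensional ℝ V]
  [MeasurableSpace V] [BorelSpace V] {ι : Type*} [Fintype ι]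

lemma transportNorm_ne_top (b : OrthonormalBasis ι ℝ V) (v : 𝓢(V, ℂ)) :
    transportNorm b v ≠ ⊤ := by
  rw [transportNorm, ENNReal.add_ne_top, ENNReal.sum_ne_top]
  exact ⟨fun i _ ↦ (SchwartzMap.memLp _ _ _).2.ne, (SchwartzMap.memLp _ _ _).2.ne⟩

lemma eLpNorm_lineDeriv_lineDeriv_heat_le_of_le (b : OrthonormalBasis ι ℝ V) (f : 𝓢(V, ℂ))
    (i j : ι) {s t : ℝ} (hs : 0 < s) (hst : s ≤ t) :
    eLpNorm (∂_{b j} (heat t (∂_{b i} f)) : 𝓢(V, ℂ)) 2 volume ≤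
      ENNReal.ofReal (2 / s) * eLpNorm (heat (s / 2) f) 2 volume := by
  have ht := hs.trans_le hst
  rw [← lineDeriv_heat ht.le]
  refine (eLpNorm_lineDeriv_lineDeriv_heat_le ht f (b j) (b i)).trans ?_
  rw [b.norm_eq_one, b.norm_eq_one, one_mul, one_mul]
  exact mul_le_mul' (ENNReal.ofReal_le_ofReal (by gcongr))
    (eLpNorm_heat_antitone f (by positivity) (by linarith))

/-- The transport of a heat flow by a vector field, at a fixed time. -/
lemma enorm_integral_mul_lineDeriv_heat_le (b : OrthonormalBasis ι ℝ V)
    (hn : 2 < Module.finrank ℝ V) (v f : 𝓢(V, ℂ)) (i : ι) {s : ℝ} (hs : 0 < s) (β : ℝ) :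
    ‖∫ x, f x * (v x * heat (2 * s) (∂_{b i} f) x)‖ₑ ≤
      transportConst ι V * transportNorm b v * (heatEnergy f s +
        ∫⁻ θ in Set.Ioo (0 : ℝ) 1, (ENNReal.ofReal (θ ^ (-β)) * heatEnergy f (s / 2) +
          ENNReal.ofReal (θ ^ β) * heatEnergy f (s * θ))) := by
  set N := transportConst ι V * transportNorm b v with hN
  have hN' : N ≠ ⊤ := ENNReal.mul_ne_top transportConst_ne_top (transportNorm_ne_top b v)
  set φ : ℝ → ℝ≥0∞ := fun a ↦ eLpNorm (heat a f) 2 volume with hφ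
  have hφ' (a : ℝ) : φ a ≠ ⊤ := (SchwartzMap.memLp _ _ _).2.ne
  set g : 𝓢(V, ℂ) := ∂_{b i} f with hg
  set Q : ℝ → ℂ := fun r ↦ ∫ x, heat (s - r) f x * (v x * heat (s + r) g x) with hQ
  set D : ℝ → ℂ := fun r ↦ ∫ x, (heat (s - r) f x * (v x * heat (s + r) (Δ g) x) -
        heat (s - r) (Δ f) x * (v x * heat (s + r) g x)) with hD
  have hder (r) (hr : r ∈ Set.Ioo 0 s) : HasDerivAt Q (D r) r := hasDerivAt_integral_heat_mul v f g hr
  have hDb (r) (hr : r ∈ Set.Ioo 0 s) :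
      ‖D r‖ₑ ≤ N * (φ (s - r) * (ENNReal.ofReal (2 / s) * φ (s / 2))) := by
    have h1 : 0 ≤ s - r := by linarith [hr.2]
    have h2 : 0 ≤ s + r := by linarith [hr.1]
    have e : D r = ∫ x, (heat (s - r) f x * (v x * Δ (heat (s + r) g) x) -
        Δ (heat (s - r) f) x * (v x * heat (s + r) g x)) := by
      simp only [hD, laplacian_heat h1, laplacian_heat h2]
    rw [e]
    exact enorm_integral_laplacian_commutator_le b hn v _ _ fun j ↦
      eLpNorm_lineDeriv_lineDeriv_heat_le_of_le b f i j hs (by linarith [hr.1])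
  have hDi : IntegrableOn D (Set.Ioo 0 s) := by
    have hm : AEStronglyMeasurable D (volume.restrict (Set.Ioo 0 s)) := by
      refine (measurable_deriv Q).aestronglyMeasurable.congr ?_
      filter_upwards [ae_restrict_mem measurableSet_Ioo] with r hr using (hder r hr).deriv
    refine ⟨hm, ?_⟩
    have hfin : N * (φ 0 * (ENNReal.ofReal (2 / s) * φ (s / 2))) < ⊤ :=
      (ENNReal.mul_ne_top hN' (ENNReal.mul_ne_top (hφ' _)
        (ENNReal.mul_ne_top ENNReal.ofReal_ne_top (hφ' _)))).lt_top
    refine (setLIntegral_mono' measurableSet_Ioo fun r hr ↦ (hDb r hr).trans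
      (show _ ≤ N * (φ 0 * (ENNReal.ofReal (2 / s) * φ (s / 2))) from ?_)).trans_lt ?_
    · have : φ (s - r) ≤ φ 0 := eLpNorm_heat_antitone f le_rfl (by linarith [hr.2])
      gcongr
    · rw [setLIntegral_const]
      exact ENNReal.mul_lt_top hfin (by simp)
  have hFTC : Q s = Q 0 + ∫ r in (0 : ℝ)..s, D r := by
    rw [intervalIntegral.integral_eq_sub_of_hasDerivAt_of_le hs.le
      (continuousOn_integral_heat_mul v f g hs.le) hder
      ((intervalIntegrable_iff_integrableOn_Ioo_of_le hs.le).2 hDi)]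
    ring
  have hQs : Q s = ∫ x, f x * (v x * heat (2 * s) g x) := by
    simp only [hQ, sub_self, heat_zero, two_mul]
  have hQ0 : ‖Q 0‖ₑ ≤ N * heatEnergy f s := by
    have e : Q 0 = -(1 / 2) * ∫ x, heat s f x * (∂_{b i} v x * heat s f x) := by
      simp only [hQ, sub_zero, add_zero, hg, ← lineDeriv_heat hs.le]
      rw [integral_mul_mul_lineDeriv_self]
      congr 2
      ext x
      ring
    rw [e, enorm_mul, ← sq_eLpNorm_heat hs.le]
    have hc : ‖(-(1 / 2) : ℂ)‖ₑ ≤ transportConst ι V := by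
      refine le_trans ?_ (le_add_self (a := (2 : ℝ≥0∞)))
      rw [← ofReal_norm]
      refine ENNReal.ofReal_le_of_le_toReal ?_
      norm_num
    have hM : eLpNorm (∂_{b i} v : 𝓢(V, ℂ)) ⊤ volume ≤ transportNorm b v :=
      (Finset.single_le_sum (f := fun i ↦ eLpNorm (∂_{b i} v : 𝓢(V, ℂ)) ⊤ volume)
        (fun _ _ ↦ zero_le) (Finset.mem_univ i)).trans le_self_add
    calc _ ≤ transportConst ι V * (eLpNorm (heat s f) 2 volume *
            (transportNorm b v * eLpNorm (heat s f) 2 volume)) :=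
          mul_le_mul' hc ((enorm_integral_mul_mul_le _ _ _ ⊤ 2).trans (by gcongr))
      _ = _ := by rw [hN]; ring
  have hint : ‖∫ r in (0 : ℝ)..s, D r‖ₑ ≤ N * ∫⁻ θ in Set.Ioo (0 : ℝ) 1,
      (ENNReal.ofReal (θ ^ (-β)) * heatEnergy f (s / 2) +
          ENNReal.ofReal (θ ^ β) * heatEnergy f (s * θ)) := by
    rw [intervalIntegral.integral_of_le hs.le, integral_Ioc_eq_integral_Ioo]
    refine (enorm_integral_le_lintegral_enorm _).trans ?_
    refine (setLIntegral_mono' measurableSet_Ioo hDb).trans ?_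
    rw [lintegral_Ioo_comp_sub hs fun a ↦ N * (φ a * (ENNReal.ofReal (2 / s) * φ (s / 2))),
      ← lintegral_const_mul' _ _ ENNReal.ofReal_ne_top, ← lintegral_const_mul' _ _ hN']
    refine setLIntegral_mono' measurableSet_Ioo fun θ hθ ↦ ?_
    have h0 : 0 ≤ s * θ := mul_nonneg hs.le hθ.1.le
    rw [← sq_eLpNorm_heat h0, ← sq_eLpNorm_heat (by positivity : 0 ≤ s / 2)]
    have e : ENNReal.ofReal s * ENNReal.ofReal (2 / s) = 2 := by
      rw [← ENNReal.ofReal_mul hs.le, mul_div_cancel₀ _ hs.ne']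
      simp
    calc _ = ENNReal.ofReal s * ENNReal.ofReal (2 / s) * N * (φ (s / 2) * φ (s * θ)) := by ring
      _ = N * (2 * (φ (s / 2) * φ (s * θ))) := by rw [e]; ring
      _ ≤ _ := mul_le_mul' le_rfl (ENNReal.two_mul_mul_le_rpow (hφ' _) (hφ' _) hθ.1 β)
  rw [← hQs, hFTC, mul_add]
  exact (enorm_add_le _ _).trans (add_le_add hQ0 hint)

end TransportTime

section Hardy

lemma lintegral_Ioi_rpow_mul_comp_mul (Φ : ℝ → ℝ≥0∞) (γ : ℝ) {θ : ℝ} (hθ : 0 < θ) :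
    ∫⁻ s in Set.Ioi (0 : ℝ), ENNReal.ofReal (s ^ (γ - 1)) * Φ (s * θ) =
      ENNReal.ofReal (θ ^ (-γ)) * ∫⁻ s in Set.Ioi (0 : ℝ), ENNReal.ofReal (s ^ (γ - 1)) * Φ s := by
  have himg : (fun s : ℝ ↦ s * θ) '' Set.Ioi 0 = Set.Ioi 0 := by
    ext r
    constructor
    · rintro ⟨s, hs, rfl⟩
      exact mul_pos hs hθ
    · intro hr
      exact ⟨r / θ, div_pos hr hθ, div_mul_cancel₀ _ hθ.ne'⟩
  have h := lintegral_image_eq_lintegral_abs_deriv_mul (measurableSet_Ioi (a := (0 : ℝ)))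
    (f := fun s ↦ s * θ) (f' := fun _ ↦ θ)
    (fun x _ ↦ by simpa using ((hasDerivAt_id x).mul_const θ).hasDerivWithinAt)
    (fun x _ y _ h ↦ by simpa [hθ.ne'] using h) fun s ↦ ENNReal.ofReal (s ^ (γ - 1)) * Φ s
  rw [himg] at h
  rw [h, ← lintegral_const_mul' _ _ ENNReal.ofReal_ne_top]
  refine setLIntegral_congr_fun measurableSet_Ioi fun s hs ↦ ?_
  have hs' : (0 : ℝ) < s := hs
  rw [abs_of_pos hθ, ← mul_assoc, ← mul_assoc, ← ENNReal.ofReal_mul (by positivity),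
    ← ENNReal.ofReal_mul (by positivity), Real.mul_rpow hs'.le hθ.le]
  congr 2
  have e : θ ^ (-γ) * θ * θ ^ (γ - 1) = 1 := by
    rw [← Real.rpow_add_one hθ.ne', ← Real.rpow_add hθ]
    simp
  linear_combination -s ^ (γ - 1) * e

/-- The constant in the weighted Hardy inequality `lintegral_Ioi_hardy`. -/
def hardyConst (γ : ℝ) : ℝ≥0∞ :=
  1 + ∫⁻ θ in Set.Ioo (0 : ℝ) 1, ENNReal.ofReal ((2 ^ γ + 1) * θ ^ (-(γ / 2)))

lemma hardyConst_ne_top {γ : ℝ} (hγ : γ < 2) : hardyConst γ ≠ ⊤ := by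
  refine ENNReal.add_ne_top.2 ⟨ENNReal.one_ne_top, ?_⟩
  have h : IntegrableOn (fun θ : ℝ ↦ (2 ^ γ + 1) * θ ^ (-(γ / 2))) (Set.Ioo 0 1) := by
    refine Integrable.const_mul ?_ _
    exact (intervalIntegrable_iff_integrableOn_Ioo_of_le zero_le_one).1
      (intervalIntegral.intervalIntegrable_rpow' (by linarith))
  exact h.lintegral_lt_top.ne

lemma lintegral_Ioi_hardy {Φ : ℝ → ℝ≥0∞} (hΦ : Measurable Φ) (γ : ℝ) :
    ∫⁻ s in Set.Ioi (0 : ℝ), ENNReal.ofReal (s ^ (γ - 1)) * (Φ s +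
      ∫⁻ θ in Set.Ioo (0 : ℝ) 1, (ENNReal.ofReal (θ ^ (-(γ / 2))) * Φ (s / 2) +
          ENNReal.ofReal (θ ^ (γ / 2)) * Φ (s * θ))) =
      hardyConst γ * ∫⁻ s in Set.Ioi (0 : ℝ), ENNReal.ofReal (s ^ (γ - 1)) * Φ s := by
  set I := ∫⁻ s in Set.Ioi (0 : ℝ), ENNReal.ofReal (s ^ (γ - 1)) * Φ s with hI
  simp only [mul_add, hardyConst, add_mul, one_mul]
  rw [lintegral_add_left (by fun_prop), ← hI]
  congr 1
  simp_rw [← lintegral_const_mul' _ _ ENNReal.ofReal_ne_top]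
  rw [lintegral_lintegral_swap (by fun_prop), ← lintegral_mul_const _ (by fun_prop)]
  refine setLIntegral_congr_fun measurableSet_Ioo fun θ hθ ↦ ?_
  have hθ' : 0 < θ := hθ.1
  simp only [mul_add]
  rw [lintegral_add_left (by fun_prop)]
  simp only [mul_left_comm (ENNReal.ofReal (_ ^ (γ - 1)))]
  rw [lintegral_const_mul' _ _ ENNReal.ofReal_ne_top,
    lintegral_const_mul' _ _ ENNReal.ofReal_ne_top]
  simp only [div_eq_mul_inv _ (2 : ℝ)]
  rw [lintegral_Ioi_rpow_mul_comp_mul Φ γ (by norm_num : (0 : ℝ) < 2⁻¹),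
    lintegral_Ioi_rpow_mul_comp_mul Φ γ hθ', ← hI, ← mul_assoc, ← mul_assoc, ← add_mul,
    ← ENNReal.ofReal_mul (by positivity), ← ENNReal.ofReal_mul (by positivity),
    ← ENNReal.ofReal_add (by positivity) (by positivity)]
  congr 2
  have e1 : (2⁻¹ : ℝ) ^ (-γ) = 2 ^ γ := by
    rw [Real.inv_rpow (by norm_num), ← Real.rpow_neg (by norm_num), neg_neg]
  rw [e1, ← Real.rpow_add hθ', show γ * 2⁻¹ + -γ = -(γ * 2⁻¹) by ring]
  ring

end Hardy

section InverseGamma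

lemma rpow_neg_sub_one_mul_exp_eq (q A : ℝ) {s : ℝ} (hs : 0 < s) :
    (|(-1 : ℝ)| * s ^ ((-1 : ℝ) - 1)) • ((s ^ (-1 : ℝ)) ^ (q - 1) * Real.exp (-(A * s ^ (-1 : ℝ)))) =
      s ^ (-q - 1) * Real.exp (-(A / s)) := by
  rw [← Real.rpow_mul hs.le, abs_neg, abs_one, one_mul, smul_eq_mul, ← mul_assoc,
    ← Real.rpow_add hs, Real.rpow_neg_one, ← div_eq_mul_inv]
  ring_nf

lemma integrableOn_rpow_mul_exp_neg_div {q A : ℝ} (hq : 0 < q) (hA : 0 < A) :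
    IntegrableOn (fun s ↦ s ^ (-q - 1) * Real.exp (-(A / s))) (Set.Ioi 0) := by
  have h := integrableOn_rpow_mul_exp_neg_mul_rpow (s := q - 1) (p := 1) (b := A)
    (by linarith) one_pos hA
  have h' : IntegrableOn (fun y : ℝ ↦ y ^ (q - 1) * Real.exp (-(A * y))) (Set.Ioi 0) := by
    simpa using h
  exact ((integrableOn_Ioi_comp_rpow_iff _ (by norm_num : (-1 : ℝ) ≠ 0)).2 h').congr_fun
    (fun s hs ↦ rpow_neg_sub_one_mul_exp_eq q A hs) measurableSet_Ioi

lemma integral_rpow_mul_exp_neg_div {q A : ℝ} (hq : 0 < q) (hA : 0 < A) :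
    ∫ s in Set.Ioi (0 : ℝ), s ^ (-q - 1) * Real.exp (-(A / s)) = A ^ (-q) * Real.Gamma q := by
  rw [← setIntegral_congr_fun measurableSet_Ioi fun s hs ↦ rpow_neg_sub_one_mul_exp_eq q A hs,
    integral_comp_rpow_Ioi (fun y : ℝ ↦ y ^ (q - 1) * Real.exp (-(A * y)))
      (by norm_num : (-1 : ℝ) ≠ 0),
    Real.integral_rpow_mul_exp_neg_mul_Ioi hq hA, one_div, Real.inv_rpow hA.le,
    Real.rpow_neg hA.le]

end InverseGamma

section HeatKernel

variable {V : Type*} [NormedAddCommGroup V]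

section Kernel

variable [InnerProductSpace ℝ V]

/-- The Gaussian heat kernel. -/
def heatKernel (t : ℝ) (z : V) : ℝ :=
  (4 * Real.pi * t) ^ (-(Module.finrank ℝ V / 2 : ℝ)) * Real.exp (-(‖z‖ ^ 2 / (4 * t)))

lemma heatKernel_nonneg {t : ℝ} (ht : 0 ≤ t) (z : V) : 0 ≤ heatKernel t z := by
  unfold heatKernel
  positivity

variable (V) in
/-- The constant relating `|z|^{-α}` to the superposition of heat kernels. -/
def rieszConst (α : ℝ) : ℝ :=
  (8 * Real.pi) ^ (-(Module.finrank ℝ V / 2 : ℝ)) * 8 ^ (α / 2) * Real.Gamma (α / 2)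

lemma rieszConst_pos {α : ℝ} (hα : 0 < α) : 0 < rieszConst V α := by
  have := Real.Gamma_pos_of_pos (half_pos hα)
  unfold rieszConst
  positivity

lemma rpow_mul_heatKernel_eq (q : ℝ) (z : V) {s : ℝ} (hs : 0 < s) :
    s ^ ((Module.finrank ℝ V : ℝ) / 2 - q - 1) * heatKernel (2 * s) z =
      (8 * Real.pi) ^ (-(Module.finrank ℝ V / 2 : ℝ)) *
        (s ^ (-q - 1) * Real.exp (-((‖z‖ ^ 2 / 8) / s))) := by
  rw [heatKernel, show 4 * Real.pi * (2 * s) = (8 * Real.pi) * s by ring,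
    Real.mul_rpow (by positivity) hs.le,
    show (Module.finrank ℝ V : ℝ) / 2 - q - 1 = (Module.finrank ℝ V / 2) + (-q - 1) by ring,
    Real.rpow_add hs, Real.rpow_neg hs.le, show ‖z‖ ^ 2 / (4 * (2 * s)) = (‖z‖ ^ 2 / 8) / s by
      ring]
  have : s ^ ((Module.finrank ℝ V : ℝ) / 2) ≠ 0 := (Real.rpow_pos_of_pos hs _).ne'
  field_simp

lemma integrableOn_rpow_mul_heatKernel {q : ℝ} (hq : 0 < q) {z : V} (hz : z ≠ 0) :
    IntegrableOn (fun s ↦ s ^ ((Module.finrank ℝ V : ℝ) / 2 - q - 1) * heatKernel (2 * s) z)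
      (Set.Ioi 0) := by
  have hA : 0 < ‖z‖ ^ 2 / 8 := by positivity
  have h : IntegrableOn (fun s ↦ (8 * Real.pi) ^ (-(Module.finrank ℝ V / 2 : ℝ)) *
      (s ^ (-q - 1) * Real.exp (-((‖z‖ ^ 2 / 8) / s)))) (Set.Ioi 0) :=
    Integrable.const_mul (integrableOn_rpow_mul_exp_neg_div hq hA) _
  exact h.congr_fun (fun s hs ↦ (rpow_mul_heatKernel_eq q z hs).symm) measurableSet_Ioi

lemma integral_rpow_mul_heatKernel {q : ℝ} (hq : 0 < q) {z : V} (hz : z ≠ 0) :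
    ∫ s in Set.Ioi (0 : ℝ), s ^ ((Module.finrank ℝ V : ℝ) / 2 - q - 1) * heatKernel (2 * s) z =
      rieszConst V (2 * q) * ‖z‖ ^ (-(2 * q)) := by
  have hA : 0 < ‖z‖ ^ 2 / 8 := by positivity
  have hz' : 0 < ‖z‖ := norm_pos_iff.2 hz
  rw [setIntegral_congr_fun measurableSet_Ioi fun s hs ↦ rpow_mul_heatKernel_eq q z hs,
    integral_const_mul, integral_rpow_mul_exp_neg_div hq hA, rieszConst,
    Real.div_rpow (by positivity) (by norm_num), ← Real.rpow_natCast, ← Real.rpow_mul hz'.le,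
    Real.rpow_neg (by norm_num : (0 : ℝ) ≤ 8), mul_div_cancel_left₀ _ (two_ne_zero),
    div_inv_eq_mul, show ((2 : ℕ) : ℝ) * -q = -(2 * q) by push_cast; ring]
  ring

lemma rieszConst_add_two {α : ℝ} (hα : 0 < α) :
    rieszConst V (α + 2) = 4 * α * rieszConst V α := by
  rw [rieszConst, rieszConst, show (α + 2) / 2 = α / 2 + 1 by ring,
    Real.Gamma_add_one (by positivity), Real.rpow_add_one (by norm_num)]
  ring

lemma hasFDerivAt_heatKernel (t : ℝ) (z : V) :
    HasFDerivAt (heatKernel t) ((-(heatKernel t z / (2 * t))) • innerSL ℝ z) z := by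
  have h1 : HasFDerivAt (fun z : V ↦ ‖z‖ ^ 2) (2 • innerSL ℝ z) z :=
    (hasStrictFDerivAt_norm_sq z).hasFDerivAt
  have h2 := (((h1.mul_const (4 * t)⁻¹).neg.exp).const_mul
    ((4 * Real.pi * t) ^ (-(Module.finrank ℝ V / 2 : ℝ))))
  refine (h2.congr_fderiv ?_).congr_of_eventuallyEq (Filter.Eventually.of_forall fun y ↦ ?_)
  · ext v
    simp [heatKernel, div_eq_mul_inv]
    ring
  · simp [heatKernel, div_eq_mul_inv]

lemma continuous_heatKernel (t : ℝ) : Continuous (heatKernel t : V → ℝ) := by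
  unfold heatKernel
  fun_prop

end Kernel

variable [InnerProductSpace ℝ V] [FiniteDimensional ℝ V] [MeasurableSpace V] [BorelSpace V]

lemma heat_apply_eq_integral_heatKernel {t : ℝ} (ht : 0 < t) (f : 𝓢(V, ℂ)) (x : V) :
    heat t f x = ∫ y, f y * (heatKernel t (x - y) : ℂ) := by
  have hb : 0 < (((4 * Real.pi ^ 2 * t : ℝ) : ℂ)).re := by
    rw [Complex.ofReal_re]; positivity
  have J := GaussianFourier.integrable_cexp_neg_mul_sq_norm_add hb (2 * Real.pi * Complex.I) x
  have h := VectorFourier.integral_fourierIntegral_smul_eq_flip (L := innerₗ V)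
      Real.continuous_fourierChar continuous_inner (f.integrable (μ := volume)) J
  have e1 (ξ : V) : VectorFourier.fourierIntegral Real.fourierChar volume (innerₗ V) f ξ =
      𝓕 f ξ := by rw [fourier_coe]; rfl
  have e2 (y : V) : VectorFourier.fourierIntegral Real.fourierChar volume (innerₗ V).flip
      (fun v : V ↦ Complex.exp (-((4 * Real.pi ^ 2 * t : ℝ) : ℂ) * ‖v‖ ^ 2 +
        2 * Real.pi * Complex.I * (inner ℝ x v : ℝ))) y = (heatKernel t (x - y) : ℂ) := by
    have := fourier_gaussian_innerProductSpace' hb x y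
    rw [flip_innerₗ]
    refine Eq.trans ?_ (this.trans ?_)
    · rfl
    · have h4 : (0 : ℝ) ≤ 4 * Real.pi * t := by positivity
      have hK : (heatKernel t (x - y) : ℂ) =
          ((4 * Real.pi * t : ℝ) : ℂ) ^ ((-(Module.finrank ℝ V / 2 : ℝ) : ℝ) : ℂ) *
            Complex.exp ((-(‖x - y‖ ^ 2 / (4 * t)) : ℝ) : ℂ) := by
        rw [heatKernel, Complex.ofReal_mul, Complex.ofReal_cpow h4, Complex.ofReal_exp]
      rw [hK]
      congr 1
      · rw [show ((-(Module.finrank ℝ V / 2 : ℝ) : ℝ) : ℂ) = -(Module.finrank ℝ V / 2 : ℂ) by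
          push_cast; ring, Complex.cpow_neg, ← Complex.inv_cpow]
        · congr 1
          push_cast
          have : (Real.pi : ℂ) ≠ 0 := by exact_mod_cast Real.pi_ne_zero
          have : (t : ℂ) ≠ 0 := by exact_mod_cast ht.ne'
          field_simp
        · rw [Complex.arg_ofReal_of_nonneg h4]
          exact Real.pi_ne_zero.symm
      · congr 1
        push_cast
        have : (Real.pi : ℂ) ≠ 0 := by exact_mod_cast Real.pi_ne_zero
        field_simp
  simp only [e1, e2, smul_eq_mul] at h
  rw [← h, heat_apply_eq_integral ht.le]
  congr 1
  ext ξ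
  rw [Real.fourierChar_apply, heatSymbol, Complex.ofReal_exp, ← mul_assoc, ← Complex.exp_add,
    mul_comm, real_inner_comm]
  congr 2
  push_cast
  ring

lemma heat_lineDeriv_apply_eq_integral {t : ℝ} (ht : 0 < t) {f : 𝓢(V, ℂ)}
    (hf : HasCompactSupport f) (m x : V) :
    heat t (∂_{m} f) x =
      ∫ y, f y * ((-(inner ℝ (x - y) m / (2 * t)) * heatKernel t (x - y) : ℝ) : ℂ) := by
  have hK (y : V) : HasFDerivAt (fun y ↦ (heatKernel t (x - y) : ℂ))
      (Complex.ofRealCLM ∘L ((heatKernel t (x - y) / (2 * t)) • innerSL ℝ (x - y))) y := by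
    have h := Complex.ofRealCLM.hasFDerivAt.comp y
      ((hasFDerivAt_heatKernel t (x - y)).comp y ((hasFDerivAt_id y).const_sub x))
    refine h.congr_fderiv ?_
    ext v
    simp
  have hfd (y : V) : fderiv ℝ (fun y ↦ (heatKernel t (x - y) : ℂ)) y m =
      ((inner ℝ (x - y) m / (2 * t) * heatKernel t (x - y) : ℝ) : ℂ) := by
    rw [(hK y).fderiv]
    simp [-map_sub]
    ring
  have hc : Continuous fun y ↦ (heatKernel t (x - y) : ℂ) :=
    Complex.continuous_ofReal.comp ((continuous_heatKernel t).comp (by fun_prop))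
  have hd : Continuous fun y ↦ fderiv ℝ (fun y ↦ (heatKernel t (x - y) : ℂ)) y m := by
    simp only [hfd]
    have := (continuous_heatKernel (V := V) t).comp (continuous_const.sub continuous_id : Continuous fun y : V ↦ x - y)
    fun_prop
  have hf' : HasCompactSupport (∂_{m} f : 𝓢(V, ℂ)) := by
    have := hf.fderiv_apply (𝕜 := ℝ) m
    exact this
  have h := integral_mul_fderiv_eq_neg_fderiv_mul_of_integrable (μ := volume) (v := m)
    (f := f) (g := fun y ↦ (heatKernel t (x - y) : ℂ))
    (((∂_{m} f : 𝓢(V, ℂ)).continuous.mul hc).integrable_of_hasCompactSupport hf'.mul_right)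
    ((f.continuous.mul hd).integrable_of_hasCompactSupport hf.mul_right)
    ((f.continuous.mul hc).integrable_of_hasCompactSupport hf.mul_right)
    (fun y _ ↦ f.differentiableAt) (fun y _ ↦ (hK y).differentiableAt)
  rw [heat_apply_eq_integral_heatKernel ht]
  simp only [neg_mul, Complex.ofReal_neg, mul_neg, integral_neg]
  simp only [hfd] at h
  rw [h, neg_neg]
  rfl

end HeatKernel

section KernelFubini

lemma measurable_rpow_mul_heatKernel {V : Type*} [NormedAddCommGroup V] [InnerProductSpace ℝ V]
    [MeasurableSpace V] [BorelSpace V] (p : ℝ) :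
    Measurable (Function.uncurry fun (s : ℝ) (z : V) ↦ s ^ p * heatKernel (2 * s) z) := by
  unfold heatKernel Function.uncurry
  fun_prop

variable {V : Type*} [NormedAddCommGroup V] [InnerProductSpace ℝ V] [FiniteDimensional ℝ V]
  [MeasurableSpace V] [BorelSpace V]

lemma locallyIntegrable_norm_rpow_neg_s1 [Nontrivial V] {β : ℝ} (hβ : β < Module.finrank ℝ V) :
    LocallyIntegrable (fun z : V ↦ ‖z‖ ^ (-β)) volume := by
  have hn : 1 ≤ Module.finrank ℝ V := Module.finrank_pos
  have hr (r : ℝ) : IntegrableOn (fun z : V ↦ ‖z‖ ^ (-β)) (Metric.ball 0 r) := by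
    rcases le_or_gt r 0 with h0 | h0
    · simp [Metric.ball_eq_empty.2 h0]
    rw [integrableOn_fun_norm_addHaar (μ := (volume : Measure V)) (f := fun y : ℝ ↦ y ^ (-β))]
    have h : IntegrableOn (fun y : ℝ ↦ y ^ ((Module.finrank ℝ V : ℝ) - 1 - β)) (Set.Ioo 0 r) :=
      (intervalIntegral.integrableOn_Ioo_rpow_iff h0).2 (by linarith)
    refine h.congr_fun (fun y hy ↦ ?_) measurableSet_Ioo
    rw [smul_eq_mul, ← Real.rpow_natCast, ← Real.rpow_add hy.1, Nat.cast_sub hn, Nat.cast_one,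
      ← sub_eq_add_neg]
  intro x
  exact ⟨Metric.ball 0 (‖x‖ + 1), Metric.isOpen_ball.mem_nhds (by simp), hr _⟩

lemma locallyIntegrable_norm_rpow_mul_inner [Nontrivial V] {α : ℝ}
    (hα : α + 1 < Module.finrank ℝ V) (m : V) :
    LocallyIntegrable (fun z : V ↦ ‖z‖ ^ (-α - 2) * inner ℝ z m) volume := by
  refine ((locallyIntegrable_norm_rpow_neg_s1 hα).smul ‖m‖).mono ?_
    (Filter.Eventually.of_forall fun z ↦ ?_)
  · refine Measurable.aestronglyMeasurable ?_
    fun_prop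
  rcases eq_or_ne z 0 with rfl | hz
  · simp only [inner_zero_left, mul_zero, norm_zero]
    positivity
  have hz' : 0 < ‖z‖ := norm_pos_iff.2 hz
  simp only [Pi.smul_apply, smul_eq_mul, norm_mul, Real.norm_eq_abs,
    abs_of_nonneg (Real.rpow_nonneg hz'.le _), abs_norm]
  calc ‖z‖ ^ (-α - 2) * |inner ℝ z m| ≤ ‖z‖ ^ (-α - 2) * (‖z‖ * ‖m‖) := by
        gcongr
        exact abs_real_inner_le_norm z m
    _ = ‖m‖ * ‖z‖ ^ (-(α + 1)) := by
        rw [show -(α + 1) = -α - 2 + 1 by ring, Real.rpow_add_one hz'.ne']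
        ring

lemma integrable_mul_mul_comp_sub {κ : V → ℝ} (hκ : LocallyIntegrable κ volume) {a f : V → ℂ}
    (ha : Continuous a) (ha' : HasCompactSupport a) (hf : Continuous f)
    (hf' : HasCompactSupport f) :
    Integrable (fun p : V × V ↦ a p.1 * f p.2 * (κ (p.1 - p.2) : ℂ)) (volume.prod volume) := by
  obtain ⟨r, hr⟩ := ha'.isCompact.isBounded.subset_closedBall 0
  obtain ⟨r', hr'⟩ := hf'.isCompact.isBounded.subset_closedBall 0
  have hκ' : Integrable ((Metric.closedBall (0 : V) (r + r')).indicator fun z ↦ (κ z : ℂ)) :=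
    (integrable_indicator_iff measurableSet_closedBall).2
      (hκ.integrableOn_isCompact (isCompact_closedBall _ _)).ofReal
  have h := (hf.integrable_of_hasCompactSupport hf' (μ := volume)).convolution_integrand
    (ContinuousLinearMap.mul ℝ ℂ) hκ'
  obtain ⟨C, hC⟩ := ha.bounded_above_of_compact_support ha'
  refine (h.bdd_mul (c := C) (f := fun p : V × V ↦ a p.1)
    (ha.comp continuous_fst).aestronglyMeasurable
    (Filter.Eventually.of_forall fun p ↦ hC p.1)).congr (Filter.Eventually.of_forall fun p ↦ ?_)
  simp only [ContinuousLinearMap.mul_apply', mul_assoc]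
  by_cases hp : a p.1 = 0
  · simp [hp]
  by_cases hq : f p.2 = 0
  · simp [hq]
  have h1 := hr (subset_tsupport _ hp)
  have h2 := hr' (subset_tsupport _ hq)
  rw [mem_closedBall_zero_iff] at h1 h2
  rw [Set.indicator_of_mem]
  rw [mem_closedBall_zero_iff]
  exact (norm_sub_le _ _).trans (add_le_add h1 h2)

lemma ae_prod_sub_ne_zero [Nontrivial V] :
    ∀ᵐ p : V × V ∂(volume.prod volume), p.1 - p.2 ≠ 0 :=
  (quasiMeasurePreserving_sub_of_right_invariant volume volume).ae
    (compl_mem_ae_iff.2 (measure_singleton 0))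

lemma integrable_and_integral_kernel_superposition [Nontrivial V] {ν : Measure ℝ} [SFinite ν]
    {k : ℝ → V → ℝ} {κ : V → ℝ} (hk : Measurable (Function.uncurry k))
    (hki : ∀ z ≠ 0, Integrable (fun s ↦ k s z) ν) (hkκ : ∀ z ≠ 0, ∫ s, k s z ∂ν = κ z)
    (hkn : ∀ z ≠ 0, ∫ s, |k s z| ∂ν = |κ z|) (hκ : LocallyIntegrable κ volume) {a f : V → ℂ}
    (ha : Continuous a) (ha' : HasCompactSupport a) (hf : Continuous f)
    (hf' : HasCompactSupport f) :
    Integrable (fun s ↦ ∫ x, a x * ∫ y, f y * (k s (x - y) : ℂ)) ν ∧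
      ∫ s, (∫ x, a x * ∫ y, f y * (k s (x - y) : ℂ)) ∂ν =
        ∫ x, ∫ y, a x * f y * (κ (x - y) : ℂ) := by
  have hI := integrable_mul_mul_comp_sub hκ ha ha' hf hf'
  let F : (V × V) × ℝ → ℂ := fun q ↦ a q.1.1 * f q.1.2 * (k q.2 (q.1.1 - q.1.2) : ℂ)
  have hFm : AEStronglyMeasurable F ((volume.prod volume).prod ν) := by
    have h1 : Measurable fun q : (V × V) × ℝ ↦ k q.2 (q.1.1 - q.1.2) :=
      hk.comp (measurable_snd.prodMk (measurable_fst.fst.sub measurable_fst.snd))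
    have := ha.measurable
    have := hf.measurable
    refine Measurable.aestronglyMeasurable ?_
    fun_prop
  have hF : Integrable F ((volume.prod volume).prod ν) := by
    refine (integrable_prod_iff hFm).2 ⟨?_, ?_⟩
    · filter_upwards [ae_prod_sub_ne_zero (V := V)] with p hp
      exact Integrable.const_mul (𝕜 := ℂ) (hki _ hp).ofReal (a p.1 * f p.2)
    · refine hI.norm.congr ?_
      filter_upwards [ae_prod_sub_ne_zero (V := V)] with p hp
      simp only [F, norm_mul, Complex.norm_real, Real.norm_eq_abs]
      rw [integral_const_mul, hkn _ hp]
  have hae : ∀ᵐ s ∂ν, ∫ p, F (p, s) ∂(volume.prod volume) =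
      ∫ x, a x * ∫ y, f y * (k s (x - y) : ℂ) := by
    filter_upwards [hF.prod_left_ae] with s hs
    rw [integral_prod _ hs]
    simp only [F, mul_assoc, integral_const_mul]
  refine ⟨hF.integral_prod_right.congr hae, ?_⟩
  rw [← integral_congr_ae hae, ← integral_integral_swap (f := fun p s ↦ F (p, s)) hF,
    ← integral_prod _ hI]
  refine integral_congr_ae ?_
  filter_upwards [ae_prod_sub_ne_zero (V := V)] with p hp
  simp only [F]
  rw [integral_const_mul, integral_complex_ofReal, hkκ _ hp]

lemma integrableOn_and_integral_heatKernel [Nontrivial V] {c : V → ℝ} (hc : Measurable c) {q : ℝ}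
    (hq : 0 < q)
    (hκ : LocallyIntegrable (fun z ↦ c z * (rieszConst V (2 * q) * ‖z‖ ^ (-(2 * q)))) volume)
    {a f : V → ℂ} (ha : Continuous a) (ha' : HasCompactSupport a) (hf : Continuous f)
    (hf' : HasCompactSupport f) :
    IntegrableOn (fun s ↦ ∫ x, a x * ∫ y, f y * ((c (x - y) *
      (s ^ ((Module.finrank ℝ V : ℝ) / 2 - q - 1) * heatKernel (2 * s) (x - y)) : ℝ) : ℂ))
      (Set.Ioi 0) ∧
    ∫ s in Set.Ioi (0 : ℝ), (∫ x, a x * ∫ y, f y * ((c (x - y) *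
      (s ^ ((Module.finrank ℝ V : ℝ) / 2 - q - 1) * heatKernel (2 * s) (x - y)) : ℝ) : ℂ)) =
      ∫ x, ∫ y, a x * f y *
        ((c (x - y) * (rieszConst V (2 * q) * ‖x - y‖ ^ (-(2 * q))) : ℝ) : ℂ) := by
  refine integrable_and_integral_kernel_superposition
    (k := fun s z ↦ c z * (s ^ ((Module.finrank ℝ V : ℝ) / 2 - q - 1) * heatKernel (2 * s) z))
    ((hc.comp measurable_snd).mul (measurable_rpow_mul_heatKernel _))
    (fun z hz ↦ Integrable.const_mul (integrableOn_rpow_mul_heatKernel hq hz) _)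
    (fun z hz ↦ ?_) (fun z hz ↦ ?_) hκ ha ha' hf hf'
  · rw [integral_const_mul, integral_rpow_mul_heatKernel hq hz]
  · have h0 : 0 ≤ rieszConst V (2 * q) * ‖z‖ ^ (-(2 * q)) :=
      mul_nonneg (rieszConst_pos (by positivity)).le (by positivity)
    rw [abs_mul, abs_of_nonneg h0, ← integral_rpow_mul_heatKernel hq hz, ← integral_const_mul]
    refine setIntegral_congr_fun measurableSet_Ioi fun s hs ↦ ?_
    have hs' : (0 : ℝ) ≤ 2 * s := by linarith [Set.mem_Ioi.1 hs]
    have h1 : 0 ≤ s ^ ((Module.finrank ℝ V : ℝ) / 2 - q - 1) * heatKernel (2 * s) z :=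
      mul_nonneg (Real.rpow_nonneg hs.le _) (heatKernel_nonneg hs' z)
    simp only [abs_mul (c z), abs_of_nonneg h1]

variable {α : ℝ} {a : V → ℂ} {f : 𝓢(V, ℂ)}

lemma integrableOn_and_integral_mul_heat [Nontrivial V] (hα : 0 < α)
    (hα' : α < Module.finrank ℝ V) (ha : Continuous a) (ha' : HasCompactSupport a)
    (hf : HasCompactSupport f) :
    IntegrableOn (fun s ↦ ((s ^ (((Module.finrank ℝ V : ℝ) - α) / 2 - 1) : ℝ) : ℂ) *
      ∫ x, a x * heat (2 * s) f x) (Set.Ioi 0) ∧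
    ∫ s in Set.Ioi (0 : ℝ), ((s ^ (((Module.finrank ℝ V : ℝ) - α) / 2 - 1) : ℝ) : ℂ) *
      (∫ x, a x * heat (2 * s) f x) =
      rieszConst V α * ∫ x, ∫ y, a x * f y * ((‖x - y‖ ^ (-α) : ℝ) : ℂ) := by
  have hκ : LocallyIntegrable (fun z : V ↦ (1 : ℝ) *
      (rieszConst V (2 * (α / 2)) * ‖z‖ ^ (-(2 * (α / 2))))) volume := by
    rw [mul_div_cancel₀ _ two_ne_zero]
    exact ((locallyIntegrable_norm_rpow_neg_s1 hα').smul (rieszConst V α)).congr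
      (by simp only [one_mul]; rfl)
  obtain ⟨h1, h2⟩ := integrableOn_and_integral_heatKernel (c := fun _ : V ↦ (1 : ℝ))
    measurable_const (half_pos hα) hκ ha ha' f.continuous hf
  have e (s : ℝ) (hs : s ∈ Set.Ioi 0) : (∫ x, a x * ∫ y, f y * ((1 *
      (s ^ ((Module.finrank ℝ V : ℝ) / 2 - α / 2 - 1) * heatKernel (2 * s) (x - y)) : ℝ) : ℂ)) =
      ((s ^ (((Module.finrank ℝ V : ℝ) - α) / 2 - 1) : ℝ) : ℂ) * ∫ x, a x * heat (2 * s) f x := by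
    have hs' : (0 : ℝ) < 2 * s := by linarith [Set.mem_Ioi.1 hs]
    rw [← integral_const_mul]
    refine integral_congr_ae (Filter.Eventually.of_forall fun x ↦ ?_)
    simp only [heat_apply_eq_integral_heatKernel hs', ← integral_const_mul]
    refine integral_congr_ae (Filter.Eventually.of_forall fun y ↦ ?_)
    simp only [one_mul, sub_div]
    push_cast
    ring
  refine ⟨h1.congr_fun e measurableSet_Ioi, ?_⟩
  rw [← setIntegral_congr_fun measurableSet_Ioi e, h2, ← integral_const_mul]
  refine integral_congr_ae (Filter.Eventually.of_forall fun x ↦ ?_)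
  simp only [← integral_const_mul]
  refine integral_congr_ae (Filter.Eventually.of_forall fun y ↦ ?_)
  simp only [mul_div_cancel₀ _ (two_ne_zero (α := ℝ))]
  push_cast
  ring

lemma integrableOn_and_integral_mul_heat_lineDeriv [Nontrivial V] (hα : 0 < α)
    (hα' : α + 1 < Module.finrank ℝ V) (ha : Continuous a) (ha' : HasCompactSupport a)
    (hf : HasCompactSupport f) (m : V) :
    IntegrableOn (fun s ↦ ((s ^ (((Module.finrank ℝ V : ℝ) - α) / 2 - 1) : ℝ) : ℂ) *
      ∫ x, a x * heat (2 * s) (∂_{m} f) x) (Set.Ioi 0) ∧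
    ∫ s in Set.Ioi (0 : ℝ), ((s ^ (((Module.finrank ℝ V : ℝ) - α) / 2 - 1) : ℝ) : ℂ) *
      (∫ x, a x * heat (2 * s) (∂_{m} f) x) =
      rieszConst V α * ∫ x, ∫ y, a x * f y *
        ((-α * ‖x - y‖ ^ (-α - 2) * inner ℝ (x - y) m : ℝ) : ℂ) := by
  have hq : 0 < α / 2 + 1 := by positivity
  have hq2 : 2 * (α / 2 + 1) = α + 2 := by ring
  have hc : Measurable fun z : V ↦ -(inner ℝ z m / 4) := by fun_prop
  have hκ : LocallyIntegrable (fun z : V ↦ -(inner ℝ z m / 4) *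
      (rieszConst V (2 * (α / 2 + 1)) * ‖z‖ ^ (-(2 * (α / 2 + 1))))) volume := by
    refine ((locallyIntegrable_norm_rpow_mul_inner hα' m).smul
      (-(rieszConst V (α + 2) / 4))).congr (Filter.Eventually.of_forall fun z ↦ ?_)
    simp only [hq2, Pi.smul_apply, smul_eq_mul, neg_add']
    ring
  obtain ⟨h1, h2⟩ := integrableOn_and_integral_heatKernel hc hq hκ ha ha' f.continuous hf
  have e (s : ℝ) (hs : s ∈ Set.Ioi 0) : (∫ x, a x * ∫ y, f y * ((-(inner ℝ (x - y) m / 4) *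
      (s ^ ((Module.finrank ℝ V : ℝ) / 2 - (α / 2 + 1) - 1) *
        heatKernel (2 * s) (x - y)) : ℝ) : ℂ)) =
      ((s ^ (((Module.finrank ℝ V : ℝ) - α) / 2 - 1) : ℝ) : ℂ) *
        ∫ x, a x * heat (2 * s) (∂_{m} f) x := by
    have hs0 : 0 < s := hs
    have hs' : (0 : ℝ) < 2 * s := by positivity
    rw [← integral_const_mul]
    refine integral_congr_ae (Filter.Eventually.of_forall fun x ↦ ?_)
    simp only [heat_lineDeriv_apply_eq_integral hs' hf, ← integral_const_mul]
    refine integral_congr_ae (Filter.Eventually.of_forall fun y ↦ ?_)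
    have hp : s ^ (((Module.finrank ℝ V : ℝ) - α) / 2 - 1) =
        s ^ ((Module.finrank ℝ V : ℝ) / 2 - (α / 2 + 1) - 1) * s := by
      rw [← Real.rpow_add_one hs0.ne']
      ring_nf
    simp only [hp]
    have : (s : ℂ) ≠ 0 := by exact_mod_cast hs0.ne'
    push_cast
    field_simp
    ring
  refine ⟨h1.congr_fun e measurableSet_Ioi, ?_⟩
  rw [← setIntegral_congr_fun measurableSet_Ioi e, h2, ← integral_const_mul]
  refine integral_congr_ae (Filter.Eventually.of_forall fun x ↦ ?_)
  simp only [← integral_const_mul]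
  refine integral_congr_ae (Filter.Eventually.of_forall fun y ↦ ?_)
  simp only [hq2, rieszConst_add_two hα, neg_add']
  push_cast
  ring

end KernelFubini

section RieszEnergy

variable {V : Type*} [NormedAddCommGroup V] [InnerProductSpace ℝ V] [FiniteDimensional ℝ V]
  [MeasurableSpace V] [BorelSpace V] {α : ℝ} {f : 𝓢(V, ℂ)} {μ : V → ℝ}

lemma riesz_energy_nonneg_and_lintegral_heatEnergy [Nontrivial V] (hα : 0 < α)
    (hα' : α < Module.finrank ℝ V) (hf : HasCompactSupport f) (hμ : ∀ x, f x = μ x) :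
    0 ≤ (∫ x, ∫ y, μ x * μ y * ‖x - y‖ ^ (-α)) ∧
    ∫⁻ s in Set.Ioi (0 : ℝ), ENNReal.ofReal (s ^ (((Module.finrank ℝ V : ℝ) - α) / 2 - 1)) *
      heatEnergy f s =
      ENNReal.ofReal (rieszConst V α * ∫ x, ∫ y, μ x * μ y * ‖x - y‖ ^ (-α)) := by
  obtain ⟨h1, h2⟩ := integrableOn_and_integral_mul_heat hα hα' f.continuous hf hf
  have e (s : ℝ) (hs : s ∈ Set.Ioi 0) :
      ((s ^ (((Module.finrank ℝ V : ℝ) - α) / 2 - 1) : ℝ) : ℂ) * ∫ x, f x * heat (2 * s) f x =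
      ((s ^ (((Module.finrank ℝ V : ℝ) - α) / 2 - 1) * (heatEnergy f s).toReal : ℝ) : ℂ) := by
    rw [integral_mul_heat_two_mul (fun x ↦ by rw [hμ, Complex.conj_ofReal]) (le_of_lt hs)]
    push_cast
    rfl
  have hI := (h1.congr_fun e measurableSet_Ioi).re
  simp only [RCLike.re_to_complex, Complex.ofReal_re] at hI
  rw [setIntegral_congr_fun measurableSet_Ioi e, integral_complex_ofReal] at h2
  have h3 : ∫ s in Set.Ioi (0 : ℝ), s ^ (((Module.finrank ℝ V : ℝ) - α) / 2 - 1) *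
      (heatEnergy f s).toReal = rieszConst V α * ∫ x, ∫ y, μ x * μ y * ‖x - y‖ ^ (-α) := by
    simp only [hμ, ← Complex.ofReal_mul, integral_complex_ofReal] at h2
    exact_mod_cast h2
  have h4 (s : ℝ) (hs : s ∈ Set.Ioi 0) :
      0 ≤ s ^ (((Module.finrank ℝ V : ℝ) - α) / 2 - 1) * (heatEnergy f s).toReal :=
    mul_nonneg (Real.rpow_nonneg (le_of_lt hs) _) ENNReal.toReal_nonneg
  constructor
  · have := h3 ▸ setIntegral_nonneg measurableSet_Ioi h4
    exact nonneg_of_mul_nonneg_right this (rieszConst_pos hα)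
  rw [← h3, ofReal_integral_eq_lintegral_ofReal hI (ae_restrict_of_forall_mem measurableSet_Ioi h4)]
  refine setLIntegral_congr_fun measurableSet_Ioi fun s hs ↦ ?_
  rw [Set.mem_Ioi] at hs
  simp only [ENNReal.ofReal_mul (Real.rpow_nonneg hs.le _),
    ENNReal.ofReal_toReal (heatEnergy_ne_top hs.le f)]

variable {ι : Type*} [Fintype ι]

lemma abs_integral_transport_le (b : OrthonormalBasis ι ℝ V) (hn : 2 < Module.finrank ℝ V)
    (hα : 0 < α) (hα₁ : (Module.finrank ℝ V : ℝ) - 4 < α)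
    (hα₂ : α < (Module.finrank ℝ V : ℝ) - 2) (hf : HasCompactSupport f)
    (hμ : ∀ x, f x = μ x) {v : 𝓢(V, ℂ)} {w : V → ℝ} (hw : ∀ x, v x = w x) (i : ι) :
    |∫ x, ∫ y, μ x * w x * μ y * (-α * ‖x - y‖ ^ (-α - 2) * inner ℝ (x - y) (b i))| ≤
      (transportConst ι V * transportNorm b v *
        hardyConst (((Module.finrank ℝ V : ℝ) - α) / 2)).toReal *
      ∫ x, ∫ y, μ x * μ y * ‖x - y‖ ^ (-α) := by
  have : Nontrivial V := Module.nontrivial_of_finrank_pos (R := ℝ) (by omega)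
  set γ := ((Module.finrank ℝ V : ℝ) - α) / 2 with hγ
  have hc := rieszConst_pos (V := V) hα
  obtain ⟨hE, hE'⟩ := riesz_energy_nonneg_and_lintegral_heatEnergy hα (by linarith) hf hμ
  set En := ∫ x, ∫ y, μ x * μ y * ‖x - y‖ ^ (-α) with hEn
  obtain ⟨-, h2⟩ := integrableOn_and_integral_mul_heat_lineDeriv (a := fun x ↦ f x * v x) hα
    (by linarith) (f.continuous.mul v.continuous) hf.mul_right hf (b i)
  set T := ∫ x, ∫ y, μ x * w x * μ y * (-α * ‖x - y‖ ^ (-α - 2) * inner ℝ (x - y) (b i)) with hT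
  rw [← hγ] at h2 hE'
  have hN : transportConst ι V * transportNorm b v ≠ ⊤ :=
    ENNReal.mul_ne_top transportConst_ne_top (transportNorm_ne_top b v)
  have hNH : transportConst ι V * transportNorm b v * hardyConst γ ≠ ⊤ :=
    ENNReal.mul_ne_top hN (hardyConst_ne_top (by rw [hγ]; linarith))
  have h3 : ((rieszConst V α * T : ℝ) : ℂ) = ∫ s in Set.Ioi (0 : ℝ), ((s ^ (γ - 1) : ℝ) : ℂ) *
      (∫ x, f x * v x * heat (2 * s) (∂_{b i} f) x) := by
    rw [h2]
    simp only [hμ, hw, ← Complex.ofReal_mul, integral_complex_ofReal]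
    rfl
  have h4 : ‖((rieszConst V α * T : ℝ) : ℂ)‖ₑ ≤
      transportConst ι V * transportNorm b v * hardyConst γ *
        ENNReal.ofReal (rieszConst V α * En) := by
    rw [h3, ← hE', mul_assoc _ (hardyConst γ), ← lintegral_Ioi_hardy (measurable_heatEnergy f),
      ← lintegral_const_mul' _ _ hN]
    refine (enorm_integral_le_lintegral_enorm _).trans
      (setLIntegral_mono' measurableSet_Ioi fun s hs ↦ ?_)
    rw [Set.mem_Ioi] at hs
    rw [enorm_mul, mul_left_comm, ← ofReal_norm, Complex.norm_real, Real.norm_eq_abs,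
      abs_of_nonneg (Real.rpow_nonneg hs.le _)]
    gcongr
    simp only [mul_assoc (f _)]
    exact enorm_integral_mul_lineDeriv_heat_le b hn v f i hs (γ / 2)
  rw [← ofReal_norm, Complex.norm_real, Real.norm_eq_abs, abs_mul, abs_of_pos hc,
    ← ENNReal.ofReal_toReal hNH, ← ENNReal.ofReal_mul ENNReal.toReal_nonneg,
    ENNReal.ofReal_le_ofReal_iff (by positivity)] at h4
  refine le_of_mul_le_mul_left (h4.trans_eq ?_) hc
  ring

end RieszEnergy

section VectorField

lemma lineDeriv_apply_of_eq_clm_comp {V F G : Type*} [NormedAddCommGroup V] [NormedSpace ℝ V]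
    [NormedAddCommGroup F] [NormedSpace ℝ F] [NormedAddCommGroup G] [NormedSpace ℝ G]
    {U : 𝓢(V, F)} {v : 𝓢(V, G)} (L : F →L[ℝ] G) (h : ∀ x, v x = L (U x)) (m x : V) :
    ∂_{m} v x = L (∂_{m} U x) := by
  have hv : (v : V → G) = L ∘ U := funext h
  rw [lineDerivOp_apply_eq_fderiv, lineDerivOp_apply_eq_fderiv, hv,
    (L.hasFDerivAt.comp x (U.hasFDerivAt x)).fderiv]
  rfl

variable {d : ℕ}

/-- The complexified coordinate functional. -/
def complexCoord (i : Fin d) : EuclideanSpace ℝ (Fin d) →L[ℝ] ℂ :=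
  Complex.ofRealCLM ∘L EuclideanSpace.proj i

lemma complexCoord_apply (i : Fin d) (x : EuclideanSpace ℝ (Fin d)) :
    complexCoord i x = (x i : ℂ) := rfl

lemma norm_complexCoord_apply_le (i : Fin d) (x : EuclideanSpace ℝ (Fin d)) :
    ‖complexCoord i x‖ ≤ ‖x‖ := by
  rw [complexCoord_apply, Complex.norm_real]
  exact PiLp.norm_apply_le x i

lemma laplacian_apply_eq_vecLap
    (U : 𝓢(EuclideanSpace ℝ (Fin d), EuclideanSpace ℝ (Fin d))) :
    (Δ U : 𝓢(EuclideanSpace ℝ (Fin d), EuclideanSpace ℝ (Fin d))) = vecLap d U := by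
  ext1 x
  rw [laplacian_eq_sum (EuclideanSpace.basisFun (Fin d) ℝ), sum_apply, vecLap]
  refine Finset.sum_congr rfl fun i _ ↦ ?_
  rw [EuclideanSpace.basisFun_apply, lineDerivOp_apply_eq_fderiv]
  congr 2

lemma transportNorm_coord_le [NeZero d]
    {U : 𝓢(EuclideanSpace ℝ (Fin d), EuclideanSpace ℝ (Fin d))} (hU : HasCompactSupport U)
    {v : 𝓢(EuclideanSpace ℝ (Fin d), ℂ)} {i : Fin d} (hv : ∀ x, v x = complexCoord i (U x)) :
    transportNorm (EuclideanSpace.basisFun (Fin d) ℝ) v ≤ ENNReal.ofReal (d *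
      ((⨆ x, ‖fderiv ℝ U x‖) + (∫ x, ‖vecLap d U x‖ ^ (d : ℝ)) ^ (d : ℝ)⁻¹)) := by
  have hd : (1 : ℝ) ≤ d := by exact_mod_cast NeZero.one_le
  have hbdd : BddAbove (Set.range fun x ↦ ‖fderiv ℝ U x‖) := by
    obtain ⟨C, hC⟩ := ((U.smooth 1).continuous_fderiv one_ne_zero).bounded_above_of_compact_support
      (hU.fderiv ℝ)
    exact ⟨C, Set.forall_mem_range.2 hC⟩
  have hS : 0 ≤ ⨆ x, ‖fderiv ℝ U x‖ := Real.iSup_nonneg fun _ ↦ norm_nonneg _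
  have hL : 0 ≤ (∫ x, ‖vecLap d U x‖ ^ (d : ℝ)) ^ (d : ℝ)⁻¹ := by positivity
  have h1 (j : Fin d) : eLpNorm (∂_{EuclideanSpace.basisFun (Fin d) ℝ j} v : 𝓢(_, ℂ)) ⊤ volume ≤
      ENNReal.ofReal (⨆ x, ‖fderiv ℝ U x‖) := by
    rw [eLpNorm_exponent_top]
    refine eLpNormEssSup_le_of_ae_bound (Filter.Eventually.of_forall fun x ↦ ?_)
    rw [lineDeriv_apply_of_eq_clm_comp _ hv, lineDerivOp_apply_eq_fderiv]
    refine (norm_complexCoord_apply_le _ _).trans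
      (((fderiv ℝ U x).le_opNorm _).trans ?_)
    rw [(EuclideanSpace.basisFun (Fin d) ℝ).norm_eq_one, mul_one]
    exact le_ciSup hbdd x
  have h2 : eLpNorm (Δ v : 𝓢(_, ℂ)) (Module.finrank ℝ (EuclideanSpace ℝ (Fin d))) volume ≤
      ENNReal.ofReal ((∫ x, ‖vecLap d U x‖ ^ (d : ℝ)) ^ (d : ℝ)⁻¹) := by
    have hm := (Δ U : 𝓢(EuclideanSpace ℝ (Fin d), EuclideanSpace ℝ (Fin d))).memLp (d : ℝ≥0∞) volume
    have he := hm.eLpNorm_eq_integral_rpow_norm (by simpa using NeZero.ne d) (by simp)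
    rw [laplacian_apply_eq_vecLap, ENNReal.toReal_natCast] at he
    rw [finrank_euclideanSpace_fin, ← he]
    refine eLpNorm_mono fun x ↦ ?_
    rw [← laplacian_apply_eq_vecLap]
    have : (Δ v : 𝓢(_, ℂ)) x = complexCoord i ((Δ U : 𝓢(EuclideanSpace ℝ (Fin d), EuclideanSpace ℝ (Fin d))) x) := by
      simp only [laplacian_eq_sum (EuclideanSpace.basisFun (Fin d) ℝ), sum_apply,
        map_sum]
      exact Finset.sum_congr rfl fun j _ ↦ lineDeriv_apply_of_eq_clm_comp _
        (lineDeriv_apply_of_eq_clm_comp _ hv _) _ _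
    rw [this]
    exact norm_complexCoord_apply_le _ _
  refine (add_le_add (Finset.sum_le_sum fun j _ ↦ h1 j) h2).trans ?_
  rw [Finset.sum_const, Finset.card_univ, Fintype.card_fin, nsmul_eq_mul,
    ← ENNReal.ofReal_natCast, ← ENNReal.ofReal_mul (by positivity),
    ← ENNReal.ofReal_add (by positivity) hL, mul_add]
  exact ENNReal.ofReal_le_ofReal (add_le_add le_rfl (le_mul_of_one_le_left hL hd))

lemma integral_transport_eq_sum [NeZero d] {α : ℝ} (hα : α + 1 < d)
    {μ : EuclideanSpace ℝ (Fin d) → ℝ} {u : EuclideanSpace ℝ (Fin d) → EuclideanSpace ℝ (Fin d)}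
    (hμ : Continuous μ) (hμ' : HasCompactSupport μ) (hu : Continuous u) :
    ∫ x, ∫ y, μ x * μ y * (-α * ‖x - y‖ ^ (-α - 2) * ∑ i, u x i * (x i - y i)) =
      ∑ i, ∫ x, ∫ y, μ x * u x i * μ y * (-α * ‖x - y‖ ^ (-α - 2) *
        inner ℝ (x - y) (EuclideanSpace.basisFun (Fin d) ℝ i)) := by
  have hint (i : Fin d) : Integrable (fun p : EuclideanSpace ℝ (Fin d) × EuclideanSpace ℝ (Fin d) ↦
      μ p.1 * u p.1 i * μ p.2 * (-α * ‖p.1 - p.2‖ ^ (-α - 2) *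
        inner ℝ (p.1 - p.2) (EuclideanSpace.basisFun (Fin d) ℝ i))) (volume.prod volume) := by
    have hα' : α + 1 < Module.finrank ℝ (EuclideanSpace ℝ (Fin d)) := by simpa using hα
    have hc : HasCompactSupport fun x ↦ (μ x : ℂ) := hμ'.comp_left (g := fun r : ℝ ↦ (r : ℂ)) rfl
    have h := (integrable_mul_mul_comp_sub
      ((locallyIntegrable_norm_rpow_mul_inner hα' (EuclideanSpace.basisFun (Fin d) ℝ i)).smul (-α))
      (a := fun x ↦ (μ x : ℂ) * u x i) (f := fun x ↦ (μ x : ℂ)) (by fun_prop) hc.mul_right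
      (by fun_prop) hc).re
    refine h.congr (Filter.Eventually.of_forall fun p ↦ ?_)
    simp only [← Complex.ofReal_mul, Pi.smul_apply, smul_eq_mul, RCLike.re_to_complex,
      Complex.ofReal_re, mul_assoc]
  have e (p : EuclideanSpace ℝ (Fin d) × EuclideanSpace ℝ (Fin d)) :
      μ p.1 * μ p.2 * (-α * ‖p.1 - p.2‖ ^ (-α - 2) * ∑ i, u p.1 i * (p.1 i - p.2 i)) =
      ∑ i, μ p.1 * u p.1 i * μ p.2 * (-α * ‖p.1 - p.2‖ ^ (-α - 2) *
        inner ℝ (p.1 - p.2) (EuclideanSpace.basisFun (Fin d) ℝ i)) := by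
    rw [Finset.mul_sum, Finset.mul_sum]
    refine Finset.sum_congr rfl fun i _ ↦ ?_
    rw [EuclideanSpace.basisFun_apply, EuclideanSpace.inner_single_right]
    simp only [PiLp.sub_apply, one_mul, conj_trivial]
    ring
  simp only [← integral_prod _ (hint _)]
  rw [← integral_finsetSum _ fun i _ ↦ hint i]
  simp only [← e]
  refine (integral_prod (μ := volume) (ν := volume) (fun p : EuclideanSpace ℝ (Fin d) ×
    EuclideanSpace ℝ (Fin d) ↦ μ p.1 * μ p.2 *
      (-α * ‖p.1 - p.2‖ ^ (-α - 2) * ∑ i, u p.1 i * (p.1 i - p.2 i))) ?_).symm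
  simp only [e]
  exact integrable_finsetSum _ fun i _ ↦ hint i

end VectorField

/-- Modulated interaction energy estimate for `K(x) = |x|^{-α}` with
`α ∈ (max(0,d-4), d-2)`, `d ≥ 3`: there is `C > 0` depending only on `α, d` such that for any
`μ ∈ C_c^∞(ℝ^d)` and `u ∈ C_c^∞(ℝ^d;ℝ^d)`,
`T(μ,u) ≤ C (‖∇u‖_{L^∞} + ‖Δu‖_{L^d}) E(μ)`. -/
theorem stmt_1 (d : ℕ) (hd : 3 ≤ d) (α : ℝ)
    (hα₁ : max 0 ((d : ℝ) - 4) < α) (hα₂ : α < (d : ℝ) - 2) :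
    ∃ C : ℝ, 0 < C ∧
      ∀ μ : EuclideanSpace ℝ (Fin d) → ℝ,
        ContDiff ℝ (⊤ : ℕ∞) μ → HasCompactSupport μ →
        ∀ u : EuclideanSpace ℝ (Fin d) → EuclideanSpace ℝ (Fin d),
          ContDiff ℝ (⊤ : ℕ∞) u → HasCompactSupport u →
          (∫ x, ∫ y, μ x * μ y *
              (-α * ‖x - y‖ ^ (-α - 2) * ∑ i, u x i * (x i - y i)))
            ≤ C * ((⨆ x, ‖fderiv ℝ u x‖)
                  + (∫ x, ‖vecLap d u x‖ ^ (d : ℝ)) ^ (d : ℝ)⁻¹) *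
              ∫ x, ∫ y, μ x * μ y * ‖x - y‖ ^ (-α) := by
  have : NeZero d := ⟨by omega⟩
  have hα : 0 < α := (le_max_left _ _).trans_lt hα₁
  have hα₁' : (d : ℝ) - 4 < α := (le_max_right _ _).trans_lt hα₁
  set A : ℝ := (transportConst (Fin d) (EuclideanSpace ℝ (Fin d)) *
    hardyConst (((d : ℝ) - α) / 2)).toReal
  have hA : 0 ≤ A := ENNReal.toReal_nonneg
  refine ⟨d * (A * d) + 1, by positivity, fun μ hμ hμ' u hu hu' ↦ ?_⟩
  have hμc : HasCompactSupport fun x ↦ (μ x : ℂ) := hμ'.comp_left (g := fun r : ℝ ↦ (r : ℂ)) rfl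
  have huc (i : Fin d) : HasCompactSupport fun x ↦ complexCoord i (u x) :=
    hu'.comp_left (map_zero _)
  let f : 𝓢(EuclideanSpace ℝ (Fin d), ℂ) :=
    hμc.toSchwartzMap (Complex.ofRealCLM.contDiff.comp hμ)
  let U : 𝓢(EuclideanSpace ℝ (Fin d), EuclideanSpace ℝ (Fin d)) := hu'.toSchwartzMap hu
  let v (i : Fin d) : 𝓢(EuclideanSpace ℝ (Fin d), ℂ) :=
    (huc i).toSchwartzMap ((complexCoord i).contDiff.comp hu)
  set N := (⨆ x, ‖fderiv ℝ u x‖) + (∫ x, ‖vecLap d u x‖ ^ (d : ℝ)) ^ (d : ℝ)⁻¹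
  have hN : 0 ≤ N := add_nonneg (Real.iSup_nonneg fun _ ↦ norm_nonneg _) (by positivity)
  obtain ⟨hE, -⟩ := riesz_energy_nonneg_and_lintegral_heatEnergy (f := f) (μ := μ) hα
    (by rw [finrank_euclideanSpace_fin]; linarith) hμc fun _ ↦ rfl
  set En := ∫ x, ∫ y, μ x * μ y * ‖x - y‖ ^ (-α)
  rw [integral_transport_eq_sum (by linarith) hμ.continuous hμ' hu.continuous]
  have hi (i : Fin d) : ∫ x, ∫ y, μ x * u x i * μ y * (-α * ‖x - y‖ ^ (-α - 2) *
      inner ℝ (x - y) (EuclideanSpace.basisFun (Fin d) ℝ i)) ≤ A * d * N * En := by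
    have h := abs_integral_transport_le (f := f) (μ := μ) (v := v i) (w := fun x ↦ u x i)
      (EuclideanSpace.basisFun (Fin d) ℝ) (by rw [finrank_euclideanSpace_fin]; omega) hα
      (by rwa [finrank_euclideanSpace_fin]) (by rwa [finrank_euclideanSpace_fin]) hμc
      (fun _ ↦ rfl) (fun _ ↦ rfl) i
    refine (le_abs_self _).trans (h.trans (mul_le_mul_of_nonneg_right ?_ hE))
    have hv := transportNorm_coord_le (U := U) hu' (v := v i) (i := i) fun _ ↦ rfl
    rw [finrank_euclideanSpace_fin, mul_right_comm, ENNReal.toReal_mul, mul_assoc A]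
    exact mul_le_mul_of_nonneg_left (ENNReal.toReal_le_of_le_ofReal (by positivity) hv) hA
  refine (Finset.sum_le_sum fun i _ ↦ hi i).trans ?_
  rw [Finset.sum_const, Finset.card_univ, Fintype.card_fin, nsmul_eq_mul]
  nlinarith [mul_nonneg hN hE]
end
end
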